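/- Let L_12 = {S_12, K_6 ∪ K_6, Co(12), G_1(12), G_2(12)}. The maximum number of edges of a P-free 3-graph H on 12 vertices such that H is not contained in any member of L_12 equals 25; moreover such an H has 25 edges if and only if H is isomorphic to K_5 ∪ S_7 or to K_4 ∪ S_8. -/

import Mathlib

/-- A 3-graph: a finite vertex set together with a finite set of edges
(intended to be 3-element subsets of the vertex set). -/
structure ThreeGraph where
  verts : Finset ℕ
  edges : Finset (Finset ℕ)

namespace ThreeGraph

/-- `G` is a genuine 3-uniform hypergraph: every edge is a 3-element subset of the vertex set. -/
def IsValid (G : ThreeGraph) : Prop :=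
  ∀ e ∈ G.edges, e.card = 3 ∧ e ⊆ G.verts

/-- `H.ContainsCopy F` means `F ⊆ H`: there is an injective map of the vertices of `F`
into those of `H` carrying every edge of `F` to an edge of `H`. -/
def ContainsCopy (H F : ThreeGraph) : Prop :=
  ∃ f : ℕ → ℕ, Set.InjOn f ↑F.verts ∧ (∀ v ∈ F.verts, f v ∈ H.verts) ∧
    ∀ e ∈ F.edges, e.image f ∈ H.edges

/-- `H.Free F` : `H` contains no copy of `F`. -/
def Free (H F : ThreeGraph) : Prop := ¬ H.ContainsCopy F

/-- `IsoCopy F H` : `H` is isomorphic to `F`. -/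
def IsoCopy (F H : ThreeGraph) : Prop :=
  ∃ f : ℕ → ℕ, Set.InjOn f ↑F.verts ∧ F.verts.image f = H.verts ∧
    F.edges.image (Finset.image f) = H.edges

/-- Connectivity: any two vertices are joined by a sequence of vertices in which
consecutive ones lie in a common edge. -/
def Connected (G : ThreeGraph) : Prop :=
  ∀ u ∈ G.verts, ∀ v ∈ G.verts,
    Relation.ReflTransGen (fun a b => ∃ e ∈ G.edges, a ∈ e ∧ b ∈ e) u v

/-- Shift all vertices by `k`. -/
def shiftBy (G : ThreeGraph) (k : ℕ) : ThreeGraph :=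
  ⟨G.verts.image (· + k), G.edges.image (Finset.image (· + k))⟩

/-- Vertex-disjoint union of two 3-graphs. -/
def dUnion (G H : ThreeGraph) : ThreeGraph :=
  ⟨G.verts ∪ (H.shiftBy (G.verts.sup id + 1)).verts,
   G.edges ∪ (H.shiftBy (G.verts.sup id + 1)).edges⟩

end ThreeGraph

/-- The loose 3-uniform path of length 3. -/
def pathP : ThreeGraph :=
  ⟨{0,1,2,3,4,5,6}, {{0,1,2},{2,3,4},{4,5,6}}⟩

/-- The triangle `C`. -/
def triangleC : ThreeGraph :=
  ⟨{0,1,2,3,4,5}, {{0,1,2},{2,3,4},{4,5,0}}⟩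

/-- The matching `M`: two disjoint edges. -/
def matchingM : ThreeGraph :=
  ⟨{0,1,2,3,4,5}, {{0,1,2},{3,4,5}}⟩

/-- `P_2`: two edges sharing exactly one vertex. -/
def pairP2 : ThreeGraph :=
  ⟨{0,1,2,3,4}, {{0,1,2},{2,3,4}}⟩

/-- The complete 3-graph `K_n`. -/
def KK (n : ℕ) : ThreeGraph :=
  ⟨Finset.range n, (Finset.range n).powersetCard 3⟩

/-- The full star `S_n` with center `0`. -/
def SS (n : ℕ) : ThreeGraph :=
  ⟨Finset.range n, ((Finset.range n).powersetCard 3).filter (fun e => 0 ∈ e)⟩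

/-- `G_1(n)` with `x,y,z,v = 0,1,2,3`. -/
def G1 (n : ℕ) : ThreeGraph :=
  ⟨Finset.range n,
   insert {0,1,2}
     (((Finset.range n).powersetCard 3).filter
       (fun h => 3 ∈ h ∧ (h ∩ ({0,1,2} : Finset ℕ)).Nonempty))⟩

/-- `G_2(n)` with `x,y,z = 0,1,2`. -/
def G2 (n : ℕ) : ThreeGraph :=
  ⟨Finset.range n,
   insert {0,1,2}
     (((Finset.range n).powersetCard 3).filter
       (fun h => (h ∩ ({0,1,2} : Finset ℕ)).card = 2))⟩

/-- `G_3(n)` with `x,y₁,y₂,z₁,z₂ = 0,1,2,3,4`. -/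
def G3 (n : ℕ) : ThreeGraph :=
  ⟨Finset.range n,
   ((({0,1,2,3,4} : Finset ℕ).powersetCard 3) \ {{1,2,3},{1,2,4}}) ∪
     ((Finset.range n \ ({0,1,2,3,4} : Finset ℕ)).biUnion (fun w => {{0,3,w},{0,4,w}}))⟩

/-- `K_5^{+t}`: `K_5` on `{0,…,4}` with `a,b = 0,1` and `t` pendant edges `{0,1,v}`. -/
def K5plus (t : ℕ) : ThreeGraph :=
  ⟨Finset.range (5 + t),
   ((Finset.range 5).powersetCard 3) ∪ ((Finset.Ico 5 (5 + t)).image (fun v => {0,1,v}))⟩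

/-- The comet `Co(n)`: a `K_4` on `{0,1,2,3}` and a full star on `{0} ∪ {4,…,n-1}`
with center `0`. -/
def comet (n : ℕ) : ThreeGraph :=
  ⟨Finset.range n,
   (({0,1,2,3} : Finset ℕ).powersetCard 3) ∪
     (((insert 0 (Finset.Ico 4 n)).powersetCard 3).filter (fun e => 0 ∈ e))⟩

/-- `W = V(H) \ U`. -/
def Wset (H : ThreeGraph) (U : Finset ℕ) : Finset ℕ := H.verts \ U

/-- `W_0`: the vertices of `W` lying in no edge of `H` entirely contained in `W`. -/
def W0set (H : ThreeGraph) (U : Finset ℕ) : Finset ℕ :=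
  (Wset H U).filter (fun v => ∀ e ∈ H.edges, e ⊆ Wset H U → v ∉ e)

/-- `W_1 = W \ W_0`. -/
def W1set (H : ThreeGraph) (U : Finset ℕ) : Finset ℕ :=
  Wset H U \ W0set H U

/-- `H_1`: the edges of `H` meeting both `U` and `W_1`. -/
def H1set (H : ThreeGraph) (U : Finset ℕ) : Finset (Finset ℕ) :=
  H.edges.filter (fun e => (e ∩ U).Nonempty ∧ (e ∩ W1set H U).Nonempty)

/-- `H[U]`: the edges of `H` entirely contained in `U`. -/
def HUset (H : ThreeGraph) (U : Finset ℕ) : Finset (Finset ℕ) :=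
  H.edges.filter (fun e => e ⊆ U)

/-- The family `L₁₂`. -/
def L12 : List ThreeGraph := [SS 12, (KK 6).dUnion (KK 6), comet 12, G1 12, G2 12]



abbrev V12 := Fin 12

/-- three triples form a loose path, in some order -/
def P3 (e f g : Finset V12) : Bool :=
  decide ((e ∩ f).card = 1 ∧ (f ∩ g).card = 1 ∧ (e ∩ g).card = 0) ||
  decide ((e ∩ f).card = 1 ∧ (f ∩ g).card = 0 ∧ (e ∩ g).card = 1) ||
  decide ((e ∩ f).card = 0 ∧ (f ∩ g).card = 1 ∧ (e ∩ g).card = 1)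

def U3 (E : Finset (Finset V12)) : Prop := ∀ e ∈ E, e.card = 3

def PF (E : Finset (Finset V12)) : Prop :=
  ∀ e ∈ E, ∀ f ∈ E, ∀ g ∈ E, P3 e f g = false

@[irreducible] def ind (E : Finset (Finset V12)) (a b c : ℕ) : ℕ :=
  if ({Fin.ofNat 12 a, Fin.ofNat 12 b, Fin.ofNat 12 c} : Finset V12) ∈ E then 1 else 0

def tri (a b c : ℕ) : Finset V12 := {Fin.ofNat 12 a, Fin.ofNat 12 b, Fin.ofNat 12 c}

def indT (E : Finset (Finset V12)) (t : Finset V12) : ℕ := if t ∈ E then 1 else 0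

theorem indT_tri (E : Finset (Finset V12)) (a b c : ℕ) : indT E (tri a b c) = ind E a b c := by
  unfold indT tri ind; rfl

def WW : Finset V12 := {6,7,8,9,10,11}
def UU : Finset V12 := {0,1,2,3,4,5}

theorem ind_le (E : Finset (Finset V12)) (a b c : ℕ) : ind E a b c ≤ 1 := by
  unfold ind; split_ifs <;> simp

theorem card3_lt {t : Finset V12} (h : t.card = 3) : ∃ a b c : V12, a < b ∧ b < c ∧ t = {a,b,c} := by
  refine ⟨t.orderEmbOfFin h 0, t.orderEmbOfFin h 1, t.orderEmbOfFin h 2, ?_, ?_, ?_⟩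
  · simp
  · simp
  · have := Finset.image_orderEmbOfFin_univ t h
    conv_lhs => rw [← this]
    simp [Fin.univ_succ]
instance instDecAllL (l : List (Finset V12)) (P : Finset V12 → Prop) [DecidablePred P] :
    Decidable (∀ x, x ∈ l → P x) := List.decidableBAll P l
instance instDecExL (l : List (Finset V12)) (P : Finset V12 → Prop) [DecidablePred P] :
    Decidable (∃ x, x ∈ l ∧ P x) := List.decidableBEx P l

section CC
variable {E : Finset (Finset V12)}

theorem kill (hP : PF E) {w : V12} (hw : w ∈ WW) {p f : Finset V12} (he : insert w p ∈ E)
    (hf : f ∈ E) (a b c : ℕ)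
    (h : ∀ w ∈ WW, P3 (insert w p) f (tri a b c) = true) : ind E a b c = 0 := by
  rw [← indT_tri]
  unfold indT
  rw [if_neg]
  intro ht
  have := hP _ he _ hf _ ht
  rw [h w hw] at this
  cases this

theorem conf (hP : PF E) {w : V12} (hw : w ∈ WW) {p : Finset V12} (he : insert w p ∈ E)
    (a b c a' b' c' : ℕ) (h : ∀ w ∈ WW, P3 (insert w p) (tri a b c) (tri a' b' c') = true) :
    ind E a b c + ind E a' b' c' ≤ 1 := by
  rw [← indT_tri, ← indT_tri]
  unfold indT
  split_ifs with h1 h2 <;> simp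
  have := hP _ he _ h1 _ h2
  rw [h w hw] at this
  cases this

def SU (E : Finset (Finset V12)) : ℕ := (E.filter (· ⊆ UU)).card

def list20 : List (Finset V12) :=
  [tri 0 1 2,tri 0 1 3,tri 0 1 4,tri 0 1 5,tri 0 2 3,tri 0 2 4,tri 0 2 5,tri 0 3 4,tri 0 3 5,tri 0 4 5,
   tri 1 2 3,tri 1 2 4,tri 1 2 5,tri 1 3 4,tri 1 3 5,tri 1 4 5,tri 2 3 4,tri 2 3 5,tri 2 4 5,tri 3 4 5]

theorem SU_eq (hU : U3 E) : SU E ≤ 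
   ind E 0 1 2 + ind E 0 1 3 + ind E 0 1 4 + ind E 0 1 5 + ind E 0 2 3
   + ind E 0 2 4 + ind E 0 2 5 + ind E 0 3 4 + ind E 0 3 5 + ind E 0 4 5
   + ind E 1 2 3 + ind E 1 2 4 + ind E 1 2 5 + ind E 1 3 4 + ind E 1 3 5
   + ind E 1 4 5 + ind E 2 3 4 + ind E 2 3 5 + ind E 2 4 5 + ind E 3 4 5 := by
  have h1 : E.filter (· ⊆ UU) ⊆ list20.toFinset.filter (· ∈ E) := by
    intro t ht
    rw [Finset.mem_filter] at ht ⊢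
    refine ⟨?_, ht.1⟩
    have h3 := hU t ht.1
    have : t ∈ UU.powersetCard 3 := Finset.mem_powersetCard.2 ⟨ht.2, h3⟩
    revert this
    have : UU.powersetCard 3 ⊆ list20.toFinset := by decide +kernel
    exact fun h => this h
  have h2 := Finset.card_le_card h1
  unfold SU
  refine h2.trans ?_
  clear h1 h2
  rw [Finset.card_filter]
  change ∑ i ∈ list20.toFinset, indT E i ≤ _
  rw [List.sum_toFinset]
  · simp only [list20, List.map_cons, List.map_nil, List.sum_cons, List.sum_nil, indT_tri]
    apply le_of_eq
    ring
  · decide +kernel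

theorem SU02 (hU : U3 E) (hP : PF E) (h1 : {0,1,2} ∈ E) (h2 : {2,3,4} ∈ E)
    (h3 : {0,4,5} ∈ E) {w : V12} (hw : w ∈ WW)
    (he0 : insert w {0,2} ∈ E) : SU E ≤ 11 := by
  have h := SU_eq hU
  have i := ind_le E
  have := kill hP hw he0 h2 0 1 5 (by decide +kernel)
  have := kill hP hw he0 h3 1 2 3 (by decide +kernel)
  have := kill hP hw he0 h3 1 3 4 (by decide +kernel)
  have := kill hP hw he0 h2 1 3 5 (by decide +kernel)
  have := kill hP hw he0 h2 1 4 5 (by decide +kernel)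
  have := conf hP hw he0 0 1 3 2 4 5 (by decide +kernel)
  have := conf hP hw he0 0 1 4 2 3 5 (by decide +kernel)
  have := conf hP hw he0 0 3 4 1 2 5 (by decide +kernel)
  have := conf hP hw he0 0 3 5 1 2 4 (by decide +kernel)
  have := i 0 1 2
  have := i 0 2 3
  have := i 0 2 4
  have := i 0 2 5
  have := i 0 4 5
  have := i 2 3 4
  have := i 3 4 5
  clear i
  omega

theorem SU24 (hU : U3 E) (hP : PF E) (h1 : {0,1,2} ∈ E) (h2 : {2,3,4} ∈ E)
    (h3 : {0,4,5} ∈ E) {w : V12} (hw : w ∈ WW)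
    (he0 : insert w {2,4} ∈ E) : SU E ≤ 11 := by
  have h := SU_eq hU
  have i := ind_le E
  have := kill hP hw he0 h3 0 1 3 (by decide +kernel)
  have := kill hP hw he0 h1 0 3 5 (by decide +kernel)
  have := kill hP hw he0 h3 1 2 3 (by decide +kernel)
  have := kill hP hw he0 h1 1 3 5 (by decide +kernel)
  have := kill hP hw he0 h1 3 4 5 (by decide +kernel)
  have := conf hP hw he0 0 1 4 2 3 5 (by decide +kernel)
  have := conf hP hw he0 0 1 5 0 2 3 (by decide +kernel)
  have := conf hP hw he0 0 2 5 1 3 4 (by decide +kernel)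
  have := conf hP hw he0 0 3 4 1 2 5 (by decide +kernel)
  have := i 0 1 2
  have := i 0 2 4
  have := i 0 4 5
  have := i 1 2 4
  have := i 1 4 5
  have := i 2 3 4
  have := i 2 4 5
  clear i
  omega

theorem SU04 (hU : U3 E) (hP : PF E) (h1 : {0,1,2} ∈ E) (h2 : {2,3,4} ∈ E)
    (h3 : {0,4,5} ∈ E) {w : V12} (hw : w ∈ WW)
    (he0 : insert w {0,4} ∈ E) : SU E ≤ 11 := by
  have h := SU_eq hU
  have i := ind_le E
  have := kill hP hw he0 h2 0 1 5 (by decide +kernel)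
  have := kill hP hw he0 h2 1 2 5 (by decide +kernel)
  have := kill hP hw he0 h1 1 3 5 (by decide +kernel)
  have := kill hP hw he0 h1 2 3 5 (by decide +kernel)
  have := kill hP hw he0 h1 3 4 5 (by decide +kernel)
  have := conf hP hw he0 0 1 3 2 4 5 (by decide +kernel)
  have := conf hP hw he0 0 2 3 1 4 5 (by decide +kernel)
  have := conf hP hw he0 0 2 5 1 2 3 (by decide +kernel)
  have := conf hP hw he0 0 3 5 1 2 4 (by decide +kernel)
  have := i 0 1 2
  have := i 0 1 4
  have := i 0 2 4
  have := i 0 3 4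
  have := i 0 4 5
  have := i 1 3 4
  have := i 2 3 4
  clear i
  omega

theorem SU03 (hU : U3 E) (hP : PF E) (h1 : {0,1,2} ∈ E) (h2 : {2,3,4} ∈ E)
    (h3 : {0,4,5} ∈ E) {w : V12} (hw : w ∈ WW)
    (he0 : insert w {0,3} ∈ E) : SU E ≤ 10 := by
  have h := SU_eq hU
  have i := ind_le E
  have := kill hP hw he0 h2 0 1 5 (by decide +kernel)
  have := kill hP hw he0 h3 1 2 3 (by decide +kernel)
  have := kill hP hw he0 h3 1 2 4 (by decide +kernel)
  have := kill hP hw he0 h2 1 2 5 (by decide +kernel)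
  have := kill hP hw he0 h1 1 4 5 (by decide +kernel)
  have := kill hP hw he0 h1 2 4 5 (by decide +kernel)
  have := kill hP hw he0 h1 3 4 5 (by decide +kernel)
  have := conf hP hw he0 0 1 4 2 3 5 (by decide +kernel)
  have := conf hP hw he0 0 2 4 1 3 5 (by decide +kernel)
  have := conf hP hw he0 0 2 5 1 3 4 (by decide +kernel)
  have := i 0 1 2
  have := i 0 1 3
  have := i 0 2 3
  have := i 0 3 4
  have := i 0 3 5
  have := i 0 4 5
  have := i 2 3 4
  clear i
  omega

theorem SU03_25 (hU : U3 E) (hP : PF E) (h1 : {0,1,2} ∈ E) (h2 : {2,3,4} ∈ E)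
    (h3 : {0,4,5} ∈ E) {w : V12} (hw : w ∈ WW)
    (he0 : insert w {0,3} ∈ E) (he1 : insert w {2,5} ∈ E) : SU E ≤ 8 := by
  have h := SU_eq hU
  have i := ind_le E
  have := kill hP hw he0 h2 0 1 5 (by decide +kernel)
  have := kill hP hw he0 h3 1 2 3 (by decide +kernel)
  have := kill hP hw he0 h3 1 2 4 (by decide +kernel)
  have := kill hP hw he0 h2 1 2 5 (by decide +kernel)
  have := kill hP hw he0 h1 1 4 5 (by decide +kernel)
  have := kill hP hw he0 h1 2 4 5 (by decide +kernel)
  have := kill hP hw he0 h1 3 4 5 (by decide +kernel)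
  have := kill hP hw he1 h2 0 1 3 (by decide +kernel)
  have := kill hP hw he1 h2 0 1 4 (by decide +kernel)
  have := kill hP hw he1 h1 0 3 4 (by decide +kernel)
  have := kill hP hw he1 h1 1 3 4 (by decide +kernel)
  have := conf hP hw he0 0 2 4 1 3 5 (by decide +kernel)
  have := i 0 1 2
  have := i 0 2 3
  have := i 0 2 5
  have := i 0 3 5
  have := i 0 4 5
  have := i 2 3 4
  have := i 2 3 5
  clear i
  omega

theorem SU03_14 (hU : U3 E) (hP : PF E) (h1 : {0,1,2} ∈ E) (h2 : {2,3,4} ∈ E)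
    (h3 : {0,4,5} ∈ E) {w : V12} (hw : w ∈ WW)
    (he0 : insert w {0,3} ∈ E) (he1 : insert w {1,4} ∈ E) : SU E ≤ 8 := by
  have h := SU_eq hU
  have i := ind_le E
  have := kill hP hw he0 h2 0 1 5 (by decide +kernel)
  have := kill hP hw he0 h3 1 2 3 (by decide +kernel)
  have := kill hP hw he0 h3 1 2 4 (by decide +kernel)
  have := kill hP hw he0 h2 1 2 5 (by decide +kernel)
  have := kill hP hw he0 h1 1 4 5 (by decide +kernel)
  have := kill hP hw he0 h1 2 4 5 (by decide +kernel)
  have := kill hP hw he0 h1 3 4 5 (by decide +kernel)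
  have := kill hP hw he1 h3 0 2 3 (by decide +kernel)
  have := kill hP hw he1 h2 0 2 5 (by decide +kernel)
  have := kill hP hw he1 h1 0 3 5 (by decide +kernel)
  have := kill hP hw he1 h1 2 3 5 (by decide +kernel)
  have := conf hP hw he0 0 2 4 1 3 5 (by decide +kernel)
  have := i 0 1 2
  have := i 0 1 3
  have := i 0 1 4
  have := i 0 3 4
  have := i 0 4 5
  have := i 1 3 4
  have := i 2 3 4
  clear i
  omega

def P6 : List (Finset V12) := [{0,2},{2,4},{0,4},{0,3},{2,5},{1,4}]
def CE : List (Finset V12) := [{0,1,2},{2,3,4},{0,4,5}]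

def aw (E : Finset (Finset V12)) (w : V12) : ℕ := (P6.toFinset.filter (fun p => insert w p ∈ E)).card
def HW (E : Finset (Finset V12)) : ℕ := (E.filter (· ⊆ WW)).card

theorem aw_le {w : V12} (R : List (Finset V12)) (h : ∀ p ∈ P6, insert w p ∈ E → p ∈ R) :
    aw E w ≤ R.length := by
  refine le_trans (Finset.card_le_card (t := R.toFinset) ?_) (List.toFinset_card_le R)
  intro p hp
  rw [Finset.mem_filter, List.mem_toFinset] at hp
  exact List.mem_toFinset.2 (h p hp.1 hp.2)

theorem P3_false (hP : PF E) {e f g : Finset V12} (he : e ∈ E) (hf : f ∈ E) (hg : g ∈ E)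
    (h : P3 e f g = true) : False := by
  rw [hP _ he _ hf _ hg] at h
  cases h



def ab6 (a b : V12) : Bool := (a == 0 && (b == 2 || b == 3 || b == 4)) || (a == 2 && (b == 4 || b == 5)) || (a == 1 && b == 4)
theorem t1:  ∀ a b c : V12, a < b → b < c →
      ((c < 6) ∨ 6 ≤ a ∨ (b < 6 ∧ 6 ≤ c ∧ ab6 a b = true)) ∨
      P3 {a,b,c} {0,1,2} {2,3,4} = true ∨ P3 {a,b,c} {0,1,2} {0,4,5} = true ∨ P3 {a,b,c} {2,3,4} {0,4,5} := by decide +kernel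

theorem mem_WW_iff : ∀ x : V12, x ∈ WW ↔ 6 ≤ x := by decide +kernel
theorem mem_UU_iff : ∀ x : V12, x ∈ UU ↔ x < 6 := by decide +kernel
theorem ab6_P6 (a b : V12) (h : ab6 a b = true) : {a, b} ∈ P6 := by
  have key : ∀ a b : V12, ab6 a b = true → (a = 0 ∧ b = 2) ∨ (a = 2 ∧ b = 4) ∨ (a = 0 ∧ b = 4) ∨
    (a = 0 ∧ b = 3) ∨ (a = 2 ∧ b = 5) ∨ (a = 1 ∧ b = 4) := by decide +kernel
  unfold P6
  simp only [List.mem_cons]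
  rcases key a b h with ⟨rfl, rfl⟩ | ⟨rfl, rfl⟩ | ⟨rfl, rfl⟩ | ⟨rfl, rfl⟩ | ⟨rfl, rfl⟩ | ⟨rfl, rfl⟩ <;>
    simp only [true_or, or_true]

theorem shape (hU : U3 E) (hP : PF E) (hC : ∀ c ∈ CE, c ∈ E) {t : Finset V12} (ht : t ∈ E) :
    t ⊆ UU ∨ t ⊆ WW ∨ (∃ w ∈ WW, ∃ p ∈ P6, t = insert w p) := by
  have h1 := hC {0,1,2} (by simp [CE])
  have h2 := hC {2,3,4} (by simp [CE])
  have h3 := hC {0,4,5} (by simp [CE])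
  obtain ⟨a, b, c, hab, hbc, rfl⟩ := card3_lt (hU t ht)
  rcases t1 a b c hab hbc with (h | h | ⟨_, h, h'⟩) | h | h | h
  · left
    intro x hx
    rw [mem_UU_iff]
    simp only [Finset.mem_insert, Finset.mem_singleton] at hx
    rcases hx with rfl | rfl | rfl
    · exact hab.trans (hbc.trans h)
    · exact hbc.trans h
    · exact h
  · right; left
    intro x hx
    rw [mem_WW_iff]
    simp only [Finset.mem_insert, Finset.mem_singleton] at hx
    rcases hx with rfl | rfl | rfl
    · exact h
    · exact h.trans hab.le
    · exact h.trans (hab.trans hbc).le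
  · right; right
    refine ⟨c, (mem_WW_iff c).2 h, {a, b}, ab6_P6 a b h', ?_⟩
    ext x
    simp only [Finset.mem_insert, Finset.mem_singleton]
    tauto
  · exact (P3_false hP ht h1 h2 h).elim
  · exact (P3_false hP ht h1 h3 h).elim
  · exact (P3_false hP ht h2 h3 h).elim

theorem sepW (hP : PF E) (hC : ∀ c ∈ CE, c ∈ E) {t p : Finset V12} {w : V12}
    (hw : w ∈ WW) (hp : p ∈ P6) (he : insert w p ∈ E) (ht : t ∈ E) (htW : t ⊆ WW) : w ∉ t := by
  have key : ∀ p ∈ P6, p ⊆ UU ∧ ∃ c ∈ CE, c ⊆ UU ∧ (c ∩ p).card = 1 := by decide +kernel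
  intro hwt
  obtain ⟨hpU, c, hc, hcU, hcp⟩ := key p hp
  have hd : ∀ x, x ∈ UU → x ∉ WW := by decide
  apply P3_false hP ht he (hC c hc)
  have e1 : t ∩ insert w p = {w} := by
    ext x
    simp only [Finset.mem_inter, Finset.mem_insert, Finset.mem_singleton]
    constructor
    · rintro ⟨h1, h2 | h2⟩
      · exact h2
      · exact (hd x (hpU h2) (htW h1)).elim
    · rintro rfl
      exact ⟨hwt, Or.inl rfl⟩
  have e2 : insert w p ∩ c = c ∩ p := by
    ext x
    simp only [Finset.mem_inter, Finset.mem_insert]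
    constructor
    · rintro ⟨h1 | h1, h2⟩
      · exact (hd x (hcU h2) (h1 ▸ hw)).elim
      · exact ⟨h2, h1⟩
    · exact fun h => ⟨Or.inr h.2, h.1⟩
  have e3 : t ∩ c = ∅ := by
    ext x
    simp only [Finset.mem_inter, Finset.notMem_empty, iff_false]
    exact fun h => hd x (hcU h.2) (htW h.1)
  simp [P3, e1, e2, e3, hcp]

theorem mem_list20 (hU : U3 E) {t : Finset V12} (ht : t ∈ E) (h : t ⊆ UU) : t ∈ list20 := by
  have : UU.powersetCard 3 ⊆ list20.toFinset := by decide +kernel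
  exact List.mem_toFinset.1 (this (Finset.mem_powersetCard.2 ⟨h, hU t ht⟩))

theorem cnt (hU : U3 E) (hP : PF E) (hC : ∀ c ∈ CE, c ∈ E) {w0 : V12} (hw0 : w0 ∈ WW)
    (ha : 1 ≤ aw E w0) (c : ℕ) (hc : ∀ w ∈ WW, w ≠ w0 → aw E w ≤ c) :
    ∃ k, 1 ≤ k ∧ k ≤ 6 ∧ HW E ≤ (6 - k).choose 3 ∧
      E.card ≤ SU E + aw E w0 + c * (k - 1) + HW E := by
  classical
  set K := WW.filter (fun w => 1 ≤ aw E w) with hK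
  have hKW : K ⊆ WW := Finset.filter_subset _ _
  have hWc : WW.card = 6 := by decide
  have hw0K : w0 ∈ K := Finset.mem_filter.2 ⟨hw0, ha⟩
  refine ⟨K.card, Finset.card_pos.2 ⟨w0, hw0K⟩, hWc ▸ Finset.card_le_card hKW, ?_, ?_⟩
  · have : E.filter (· ⊆ WW) ⊆ (WW \ K).powersetCard 3 := by
      intro t ht
      rw [Finset.mem_filter] at ht
      rw [Finset.mem_powersetCard]
      refine ⟨?_, hU t ht.1⟩
      intro x hx
      rw [Finset.mem_sdiff]
      refine ⟨ht.2 hx, ?_⟩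
      intro hxK
      rw [hK, Finset.mem_filter] at hxK
      obtain ⟨p, hp⟩ := Finset.card_pos.1 hxK.2
      rw [Finset.mem_filter, List.mem_toFinset] at hp
      exact sepW hP hC hxK.1 hp.1 hp.2 ht.1 ht.2 hx
    have := Finset.card_le_card this
    rw [Finset.card_powersetCard, Finset.card_sdiff_of_subset hKW, hWc] at this
    exact this
  · have hsub : E ⊆ (E.filter (· ⊆ UU) ∪
        WW.biUnion (fun w => (P6.toFinset.filter (fun p => insert w p ∈ E)).image (insert w))) ∪
        E.filter (· ⊆ WW) := by
      intro t ht
      rcases shape hU hP hC ht with h | h | ⟨w, hw, p, hp, h⟩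
      · simp [ht, h]
      · simp [ht, h]
      · rw [Finset.mem_union, Finset.mem_union, Finset.mem_biUnion]
        left; right
        refine ⟨w, hw, Finset.mem_image.2 ⟨p, Finset.mem_filter.2 ⟨List.mem_toFinset.2 hp, h ▸ ht⟩, h.symm⟩⟩
    have h1 := Finset.card_le_card hsub
    have h2 := Finset.card_union_le (E.filter (· ⊆ UU) ∪
        WW.biUnion (fun w => (P6.toFinset.filter (fun p => insert w p ∈ E)).image (insert w)))
        (E.filter (· ⊆ WW))
    have h3 := Finset.card_union_le (E.filter (· ⊆ UU))
        (WW.biUnion (fun w => (P6.toFinset.filter (fun p => insert w p ∈ E)).image (insert w)))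
    have h4 : (WW.biUnion (fun w => (P6.toFinset.filter (fun p => insert w p ∈ E)).image (insert w))).card
        ≤ ∑ w ∈ WW, aw E w :=
      Finset.card_biUnion_le.trans (Finset.sum_le_sum fun w _ => Finset.card_image_le)
    have h5 : ∑ w ∈ WW, aw E w = ∑ w ∈ K, aw E w := by
      symm
      apply Finset.sum_subset hKW
      intro x hx hxK
      by_contra hne
      exact hxK (Finset.mem_filter.2 ⟨hx, Nat.one_le_iff_ne_zero.2 hne⟩)
    have h6 : ∑ w ∈ K, aw E w = aw E w0 + ∑ w ∈ K.erase w0, aw E w :=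
      (Finset.add_sum_erase _ _ hw0K).symm
    have h7 : ∑ w ∈ K.erase w0, aw E w ≤ (K.erase w0).card • c :=
      Finset.sum_le_card_nsmul _ _ _ fun w hw =>
        hc w (hKW (Finset.mem_of_mem_erase hw)) (Finset.ne_of_mem_erase hw)
    rw [Finset.card_erase_of_mem hw0K, smul_eq_mul, mul_comm] at h7
    unfold SU HW
    generalize c * (K.card - 1) = z at *
    generalize (E.filter (· ⊆ UU)).card = z1 at *
    generalize (E.filter (· ⊆ WW)).card = z2 at *
    generalize aw E w0 = z3 at *
    omega

def K66s (E : Finset (Finset V12)) : Prop :=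
  ∃ U : Finset V12, U.card = 6 ∧ ∀ e ∈ E, e ⊆ U ∨ e ∩ U = ∅
def G1s (E : Finset (Finset V12)) : Prop :=
  ∃ (T : Finset V12) (v : V12), T.card = 3 ∧ v ∉ T ∧ ∀ e ∈ E, e = T ∨ (v ∈ e ∧ (e ∩ T).Nonempty)
def G2s (E : Finset (Finset V12)) : Prop :=
  ∃ T : Finset V12, T.card = 3 ∧ ∀ e ∈ E, e = T ∨ (e ∩ T).card = 2

theorem mem_aw {w : V12} {p : Finset V12} (hp : p ∈ P6) (h : insert w p ∈ E) : 1 ≤ aw E w :=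
  Finset.card_pos.2 ⟨p, Finset.mem_filter.2 ⟨List.mem_toFinset.2 hp, h⟩⟩

theorem HW_zero (h : HW E = 0) {t : Finset V12} (ht : t ∈ E) : ¬ t ⊆ WW := by
  intro hW
  have := Finset.card_eq_zero.1 h
  have h2 : t ∈ E.filter (· ⊆ WW) := Finset.mem_filter.2 ⟨ht, hW⟩
  rw [this] at h2
  exact absurd h2 (Finset.notMem_empty _)

/-- no opposite pairs -/
theorem ccaseIII (hU : U3 E) (hP : PF E) (hC : ∀ c ∈ CE, c ∈ E)
    (hno : ∀ w ∈ WW, ∀ p ∈ P6, insert w p ∈ E → p ∈ ([{0,2},{2,4},{0,4}] : List (Finset V12))) :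
    E.card ≤ 24 ∨ K66s E ∨ G2s E := by
  by_cases hz : ∀ w ∈ WW, aw E w = 0
  · right; left
    refine ⟨UU, by decide, fun e he => ?_⟩
    rcases shape hU hP hC he with h | h | ⟨w, hw, p, hp, h⟩
    · exact Or.inl h
    · right
      have : WW ∩ UU = ∅ := by decide
      exact Finset.subset_empty.1 (this ▸ Finset.inter_subset_inter_right h)
    · have := mem_aw hp (h ▸ he)
      rw [hz w hw] at this
      omega
  push Not at hz
  obtain ⟨w0, hw0, ha⟩ := hz
  have h1 := hC {0,1,2} (by simp [CE])
  have h2 := hC {2,3,4} (by simp [CE])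
  have h3 := hC {0,4,5} (by simp [CE])
  have hS : SU E ≤ 11 := by
    obtain ⟨p, hp⟩ := Finset.card_pos.1 (Nat.pos_of_ne_zero ha)
    rw [Finset.mem_filter, List.mem_toFinset] at hp
    have h := hno w0 hw0 p hp.1 hp.2
    have he := hp.2
    simp only [List.mem_cons, List.not_mem_nil, or_false] at h
    rcases h with rfl | rfl | rfl
    · exact SU02 hU hP h1 h2 h3 hw0 he
    · exact SU24 hU hP h1 h2 h3 hw0 he
    · exact SU04 hU hP h1 h2 h3 hw0 he
  have ha3 : ∀ w ∈ WW, aw E w ≤ 3 := fun w hw => aw_le _ (hno w hw)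
  have ha0 := ha3 w0 hw0
  by_cases hall : ∀ p ∈ ([{0,2},{2,4},{0,4}] : List (Finset V12)), ∃ w ∈ WW, insert w p ∈ E
  · obtain ⟨k, hk1, hk6, hHW, hcard⟩ := cnt hU hP hC hw0 (Nat.pos_of_ne_zero ha) 3
      (fun w hw _ => ha3 w hw)
    by_cases hk : k ≤ 3
    · left
      interval_cases k <;> simp [Nat.choose] at hHW <;> omega
    · have hz : HW E = 0 := by
        interval_cases k <;> simp [Nat.choose] at hHW <;> omega
      right; right
      refine ⟨{0,2,4}, by decide, fun e he => ?_⟩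
      rcases shape hU hP hC he with h | h | ⟨w, hw, p, hp, h⟩
      · have key : ∀ t ∈ list20, t = {0,2,4} ∨ (t ∩ {0,2,4}).card = 2 ∨
          ∃ p ∈ ([{0,2},{2,4},{0,4}] : List (Finset V12)), ∀ w ∈ WW, ∃ c ∈ CE,
            P3 (insert w p) c t = true := by decide +kernel
        rcases key e (mem_list20 hU he h) with h | h | ⟨p, hp, h⟩
        · exact Or.inl h
        · exact Or.inr h
        · obtain ⟨w, hw, hwp⟩ := hall p hp
          obtain ⟨c, hc, h⟩ := h w hw
          exact (P3_false hP hwp (hC c hc) he h).elim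
      · exact (HW_zero hz he h).elim
      · right
        have hp' := hno w hw p hp (h ▸ he)
        have key : ∀ w ∈ WW, ∀ p ∈ ([{0,2},{2,4},{0,4}] : List (Finset V12)),
          ((insert w p) ∩ {0,2,4}).card = 2 := by decide +kernel
        rw [h]
        exact key w hw p hp'
  · left
    push Not at hall
    obtain ⟨p0, hp0, hn⟩ := hall
    have ha2 : ∀ w ∈ WW, aw E w ≤ 2 := by
      intro w hw
      have h := aw_le (E := E) (w := w) (([{0,2},{2,4},{0,4}] : List (Finset V12)).erase p0)
        (fun p hp hh => (List.mem_erase_of_ne (fun (heq : p = p0) => hn w hw (heq ▸ hh))).2 (hno w hw p hp hh))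
      rw [List.length_erase_of_mem hp0] at h
      exact h
    have ha0 := ha2 w0 hw0
    obtain ⟨k, hk1, hk6, hHW, hcard⟩ := cnt hU hP hC hw0 (Nat.pos_of_ne_zero ha) 2
      (fun w hw _ => ha2 w hw)
    interval_cases k <;> simp [Nat.choose] at hHW <;> omega

/-- some opposite pair -/
theorem ccaseI (hU : U3 E) (hP : PF E) (hC : ∀ c ∈ CE, c ∈ E)
    {w0 : V12} (hw0 : w0 ∈ WW) (he0 : insert w0 {0,3} ∈ E) :
    E.card ≤ 24 ∨ G1s E := by
  have h1 := hC {0,1,2} (by simp [CE])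
  have h2 := hC {2,3,4} (by simp [CE])
  have h3 := hC {0,4,5} (by simp [CE])
  have hS : SU E ≤ 10 := SU03 hU hP h1 h2 h3 hw0 he0
  have h03 : ({0,3} : Finset V12) ∈ P6 := by simp [P6]
  have ha := mem_aw h03 he0
  have hoth : ∀ w ∈ WW, w ≠ w0 → ∀ p ∈ P6, insert w p ∈ E →
      p ∈ ([{0,2},{0,3},{0,4}] : List (Finset V12)) := by
    have key : ∀ w ∈ WW, ∀ w' ∈ WW, w' ≠ w → ∀ p ∈ P6,
      p ∈ ([{0,2},{0,3},{0,4}] : List (Finset V12)) ∨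
      ∃ c ∈ CE, P3 (insert w {0,3}) (insert w' p) c = true := by decide +kernel
    intro w hw hne p hp he
    rcases key w0 hw0 w hw hne p hp with h | ⟨c, hc, h⟩
    · exact h
    · exact (P3_false hP he0 he (hC c hc) h).elim
  by_cases h25 : insert w0 {2,5} ∈ E
  · left
    have hS := SU03_25 hU hP h1 h2 h3 hw0 he0 h25
    have ha6 : aw E w0 ≤ 6 := aw_le P6 (fun p hp _ => hp)
    have ha1 : ∀ w ∈ WW, w ≠ w0 → aw E w ≤ 1 := by
      intro w hw hne
      apply aw_le [{0,2}]
      intro p hp he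
      have key : ∀ w ∈ WW, ∀ w' ∈ WW, w' ≠ w → ∀ p ∈ ([{0,2},{0,3},{0,4}] : List (Finset V12)),
        p ∈ ([{0,2}] : List (Finset V12)) ∨
        ∃ c ∈ CE, P3 (insert w {2,5}) (insert w' p) c = true := by decide +kernel
      rcases key w0 hw0 w hw hne p (hoth w hw hne p hp he) with h | ⟨c, hc, h⟩
      · exact h
      · exact (P3_false hP h25 he (hC c hc) h).elim
    obtain ⟨k, hk1, hk6, hHW, hcard⟩ := cnt hU hP hC hw0 ha 1 ha1
    interval_cases k <;> simp [Nat.choose] at hHW <;> omega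
  by_cases h14 : insert w0 {1,4} ∈ E
  · left
    have hS := SU03_14 hU hP h1 h2 h3 hw0 he0 h14
    have ha6 : aw E w0 ≤ 6 := aw_le P6 (fun p hp _ => hp)
    have ha1 : ∀ w ∈ WW, w ≠ w0 → aw E w ≤ 1 := by
      intro w hw hne
      apply aw_le [{0,4}]
      intro p hp he
      have key : ∀ w ∈ WW, ∀ w' ∈ WW, w' ≠ w → ∀ p ∈ ([{0,2},{0,3},{0,4}] : List (Finset V12)),
        p ∈ ([{0,4}] : List (Finset V12)) ∨
        ∃ c ∈ CE, P3 (insert w {1,4}) (insert w' p) c = true := by decide +kernel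
      rcases key w0 hw0 w hw hne p (hoth w hw hne p hp he) with h | ⟨c, hc, h⟩
      · exact h
      · exact (P3_false hP h14 he (hC c hc) h).elim
    obtain ⟨k, hk1, hk6, hHW, hcard⟩ := cnt hU hP hC hw0 ha 1 ha1
    interval_cases k <;> simp [Nat.choose] at hHW <;> omega
  by_cases h24 : insert w0 {2,4} ∈ E
  · left
    have ha4 : aw E w0 ≤ 4 := by
      apply aw_le [{0,2},{2,4},{0,4},{0,3}]
      intro p hp he
      simp only [P6, List.mem_cons, List.not_mem_nil, or_false] at hp ⊢
      rcases hp with h | h | h | h | h | h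
      · simp [h]
      · simp [h]
      · simp [h]
      · simp [h]
      · exact (h25 (h ▸ he)).elim
      · exact (h14 (h ▸ he)).elim
    have ha1 : ∀ w ∈ WW, w ≠ w0 → aw E w ≤ 2 := by
      intro w hw hne
      apply aw_le [{0,2},{0,4}]
      intro p hp he
      have key : ∀ w ∈ WW, ∀ w' ∈ WW, w' ≠ w → ∀ p ∈ ([{0,2},{0,3},{0,4}] : List (Finset V12)),
        p ∈ ([{0,2},{0,4}] : List (Finset V12)) ∨
        ∃ c ∈ CE, P3 (insert w {2,4}) (insert w' p) c = true := by decide +kernel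
      rcases key w0 hw0 w hw hne p (hoth w hw hne p hp he) with h | ⟨c, hc, h⟩
      · exact h
      · exact (P3_false hP h24 he (hC c hc) h).elim
    obtain ⟨k, hk1, hk6, hHW, hcard⟩ := cnt hU hP hC hw0 ha 2 ha1
    interval_cases k <;> simp [Nat.choose] at hHW <;> omega
  have hno : ∀ w ∈ WW, ∀ p ∈ P6, insert w p ∈ E →
      p ∈ ([{0,2},{0,3},{0,4}] : List (Finset V12)) := by
    intro w hw p hp he
    by_cases hne : w = w0
    · subst hne
      simp only [P6, List.mem_cons, List.not_mem_nil, or_false] at hp ⊢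
      rcases hp with h | h | h | h | h | h
      · simp [h]
      · exact (h24 (h ▸ he)).elim
      · simp [h]
      · simp [h]
      · exact (h25 (h ▸ he)).elim
      · exact (h14 (h ▸ he)).elim
    · exact hoth w hw hne p hp he
  have ha3 : ∀ w ∈ WW, aw E w ≤ 3 := fun w hw => aw_le _ (hno w hw)
  have ha0 := ha3 w0 hw0
  by_cases hall : ∀ p ∈ ([{0,2},{0,3},{0,4}] : List (Finset V12)), ∃ w ∈ WW, insert w p ∈ E
  · obtain ⟨k, hk1, hk6, hHW, hcard⟩ := cnt hU hP hC hw0 ha 3 (fun w hw _ => ha3 w hw)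
    by_cases hk : k ≤ 3
    · left
      interval_cases k <;> simp [Nat.choose] at hHW <;> omega
    · have hz : HW E = 0 := by
        interval_cases k <;> simp [Nat.choose] at hHW <;> omega
      right
      refine ⟨{2,3,4}, 0, by decide, by decide, fun e he => ?_⟩
      rcases shape hU hP hC he with h | h | ⟨w, hw, p, hp, h⟩
      · have key : ∀ t ∈ list20, (t = {2,3,4} ∨ 0 ∈ t ∧ (t ∩ {2,3,4}).Nonempty) ∨
          ∃ p ∈ ([{0,2},{0,3},{0,4}] : List (Finset V12)), ∀ w ∈ WW, ∃ c ∈ CE,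
            P3 (insert w p) c t = true := by decide +kernel
        rcases key e (mem_list20 hU he h) with h | ⟨p, hp, h⟩
        · exact h
        · obtain ⟨w, hw, hwp⟩ := hall p hp
          obtain ⟨c, hc, h⟩ := h w hw
          exact (P3_false hP hwp (hC c hc) he h).elim
      · exact (HW_zero hz he h).elim
      · right
        have hp' := hno w hw p hp (h ▸ he)
        have key : ∀ w ∈ WW, ∀ p ∈ ([{0,2},{0,3},{0,4}] : List (Finset V12)),
          0 ∈ (insert w p) ∧ ((insert w p) ∩ {2,3,4}).Nonempty := by decide +kernel
        rw [h]
        exact key w hw p hp'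
  · left
    push Not at hall
    obtain ⟨p0, hp0, hn⟩ := hall
    have ha2 : ∀ w ∈ WW, aw E w ≤ 2 := by
      intro w hw
      have h := aw_le (E := E) (w := w) (([{0,2},{0,3},{0,4}] : List (Finset V12)).erase p0)
        (fun p hp hh => (List.mem_erase_of_ne (fun (heq : p = p0) => hn w hw (heq ▸ hh))).2 (hno w hw p hp hh))
      rw [List.length_erase_of_mem hp0] at h
      exact h
    have ha0 := ha2 w0 hw0
    obtain ⟨k, hk1, hk6, hHW, hcard⟩ := cnt hU hP hC hw0 ha 2 (fun w hw _ => ha2 w hw)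
    interval_cases k <;> simp [Nat.choose] at hHW <;> omega
end CC

section CF
variable {E : Finset (Finset V12)}

def CFr (E : Finset (Finset V12)) : Prop :=
  ∀ e ∈ E, ∀ f ∈ E, ∀ g ∈ E, (e ∩ f).card = 1 → (f ∩ g).card = 1 → (e ∩ g).card = 1 →
    (e ∩ f ∩ g).Nonempty

theorem card_one_of {s : Finset V12} {a : V12} (ha : a ∈ s) (h : ∀ x ∈ s, x = a) : s.card = 1 := by
  rw [Finset.card_eq_one]
  exact ⟨a, Finset.eq_singleton_iff_unique_mem.2 ⟨ha, h⟩⟩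

theorem fact1 (hU : U3 E) (hP : PF E) (hC : CFr E) {e f h : Finset V12} {v a : V12}
    (he : e ∈ E) (hf : f ∈ E) (hh : h ∈ E) (hve : v ∈ e) (hvf : v ∈ f) (hvh : v ∉ h)
    (hef : ∀ x ∈ e, x ∈ f → x = v) (hah : a ∈ h) (hae : a ∈ e)
    (hhe : ∀ x ∈ h, x ∈ e → x = a) : ∀ y ∈ f, y ≠ v → y ∈ h := by
  have c1 : (h ∩ e).card = 1 := card_one_of (a := a) (by simp [*])
    (fun x hx => hhe x (Finset.mem_inter.1 hx).1 (Finset.mem_inter.1 hx).2)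
  have c2 : (e ∩ f).card = 1 := card_one_of (a := v) (by simp [*])
    (fun x hx => hef x (Finset.mem_inter.1 hx).1 (Finset.mem_inter.1 hx).2)
  have c0 : (h ∩ f).card ≠ 0 := by
    intro h0
    exact P3_false hP hh he hf (by simp [P3, c1, c2, h0])
  have c3 : (h ∩ f).card ≠ 1 := by
    intro h0
    obtain ⟨x, hx⟩ := hC h hh e he f hf c1 c2 h0
    simp only [Finset.mem_inter] at hx
    have := hef x hx.1.2 hx.2
    exact hvh (this ▸ hx.1.1)
  have hs : h ∩ f ⊆ f.erase v := by
    intro x hx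
    rw [Finset.mem_inter] at hx
    exact Finset.mem_erase.2 ⟨fun heq => hvh (heq ▸ hx.1), hx.2⟩
  have c4 : (f.erase v).card = 2 := by rw [Finset.card_erase_of_mem hvf, hU f hf]
  have := Finset.eq_of_subset_of_card_le hs (by omega)
  intro y hy hyv
  have : y ∈ h ∩ f := this ▸ Finset.mem_erase.2 ⟨hyv, hy⟩
  exact (Finset.mem_inter.1 this).1

theorem dc (A : Finset V12) (S : Finset (Finset V12)) :
    ∑ x ∈ A, (S.filter (fun e => x ∈ e)).card = ∑ e ∈ S, (e ∩ A).card := by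
  simp only [Finset.card_eq_sum_ones, Finset.sum_filter]
  rw [Finset.sum_comm]
  refine Finset.sum_congr rfl fun e _ => ?_
  rw [← Finset.sum_filter]
  congr 1
  ext x
  simp [and_comm]

theorem oddtown (S : Finset (Finset V12)) (h3 : ∀ e ∈ S, e.card = 3)
    (h2 : ∀ e ∈ S, ∀ f ∈ S, e ≠ f → Even (e ∩ f).card) : S.card ≤ 12 := by
  let χ : S → (V12 → ZMod 2) := fun e x => if x ∈ e.1 then 1 else 0
  have hdot : ∀ e f : S, ∑ x, χ e x * χ f x = if e = f then 1 else 0 := by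
    intro e f
    have : ∑ x, χ e x * χ f x = ((e.1 ∩ f.1).card : ZMod 2) := by
      rw [Finset.card_eq_sum_ones, Nat.cast_sum]
      simp only [χ, ← Finset.sum_filter, ite_mul, mul_ite, one_mul, mul_one, zero_mul, mul_zero]
      rw [Finset.filter_filter]
      simp only [Nat.cast_one]
      congr 1
      ext x; simp [and_comm]
    rw [this]
    split_ifs with h
    · subst h
      rw [Finset.inter_self, h3 _ e.2]; decide
    · rw [ZMod.natCast_eq_zero_iff_even]
      exact h2 _ e.2 _ f.2 (fun hh => h (Subtype.ext hh))
  have hli : LinearIndependent (ZMod 2) χ := by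
    rw [Fintype.linearIndependent_iff]
    intro g hg i
    have h1 : ∑ x, (∑ j, g j • χ j) x * χ i x = 0 := by rw [hg]; simp
    simp only [Finset.sum_apply, Pi.smul_apply, smul_eq_mul, Finset.sum_mul] at h1
    rw [Finset.sum_comm] at h1
    simp only [mul_assoc, ← Finset.mul_sum, hdot] at h1
    simpa using h1
  have := hli.fintype_card_le_finrank
  simpa using this

end CF

section CB
variable {E : Finset (Finset V12)}

/-- edges through `v` -/
def Lk (E : Finset (Finset V12)) (v : V12) : Finset (Finset V12) := E.filter (fun e => v ∈ e)
/-- edges through `v` avoiding `u` -/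
def Fk (E : Finset (Finset V12)) (v u : V12) : Finset (Finset V12) := E.filter (fun e => v ∈ e ∧ u ∉ e)
/-- third vertices of edges through `u` and `v` -/
def Xk (E : Finset (Finset V12)) (v u : V12) : Finset V12 :=
  Finset.univ.filter (fun x => x ≠ v ∧ x ≠ u ∧ {v, u, x} ∈ E)
/-- edges avoiding both `u` and `v` -/
def Tk (E : Finset (Finset V12)) (v u : V12) : Finset (Finset V12) := E.filter (fun e => v ∉ e ∧ u ∉ e)

theorem mem_Xk {v u x : V12} : x ∈ Xk E v u ↔ x ≠ v ∧ x ≠ u ∧ {v, u, x} ∈ E := by simp [Xk]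

theorem third (hU : U3 E) {v u : V12} (hvu : v ≠ u) {e : Finset V12} (he : e ∈ E) (hv : v ∈ e)
    (hu : u ∈ e) : ∃ x, x ≠ v ∧ x ≠ u ∧ e = {v, u, x} := by
  have h1 : ((e.erase v).erase u).card = 1 := by
    rw [Finset.card_erase_of_mem (Finset.mem_erase.2 ⟨hvu.symm, hu⟩), Finset.card_erase_of_mem hv, hU e he]
  obtain ⟨x, hx⟩ := Finset.card_eq_one.1 h1
  have hxm : x ∈ (e.erase v).erase u := by rw [hx]; simp
  simp only [Finset.mem_erase] at hxm
  refine ⟨x, hxm.2.1, hxm.1, ?_⟩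
  rw [← hx, Finset.insert_erase (Finset.mem_erase.2 ⟨hvu.symm, hu⟩), Finset.insert_erase hv]

theorem Lk_le (hU : U3 E) {v u : V12} (hvu : v ≠ u) :
    (Lk E v).card ≤ (Xk E v u).card + (Fk E v u).card := by
  have : Lk E v ⊆ (Xk E v u).image (fun x => {v, u, x}) ∪ Fk E v u := by
    intro e he
    simp only [Lk, Finset.mem_filter] at he
    by_cases hu : u ∈ e
    · obtain ⟨x, h1, h2, rfl⟩ := third hU hvu he.1 he.2 hu
      exact Finset.mem_union_left _ (Finset.mem_image.2 ⟨x, mem_Xk.2 ⟨h1, h2, he.1⟩, rfl⟩)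
    · exact Finset.mem_union_right _ (by simp [Fk, he, hu])
  exact (Finset.card_le_card this).trans ((Finset.card_union_le _ _).trans
    (Nat.add_le_add_right Finset.card_image_le _))

theorem Xk_le {v u : V12} (hvu : v ≠ u) : (Xk E v u).card ≤ 10 := by
  have : Xk E v u ⊆ (Finset.univ.erase v).erase u := by
    intro x hx
    have := mem_Xk.1 hx
    simp [this.1, this.2.1]
  have h := Finset.card_le_card this
  rw [Finset.card_erase_of_mem (by simp [hvu.symm]), Finset.card_erase_of_mem (by simp)] at h
  simpa using h

/-- all edges -/
theorem E_le {v u : V12} :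
    E.card ≤ (Lk E v).card + (Fk E u v).card + (Tk E v u).card := by
  have : E ⊆ Lk E v ∪ Fk E u v ∪ Tk E v u := by
    intro e he
    simp only [Lk, Fk, Tk, Finset.mem_union, Finset.mem_filter]
    tauto
  exact (Finset.card_le_card this).trans ((Finset.card_union_le _ _).trans
    (Nat.add_le_add_right (Finset.card_union_le _ _) _))

theorem bkey (hU : U3 E) (hP : PF E) (hC : CFr E) {v u x : V12} {f g : Finset V12}
    (hx : x ∈ Xk E v u) (hf : f ∈ E) (hvf : v ∈ f) (huf : u ∉ f) (hxf : x ∉ f)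
    (hg : g ∈ E) (hvg : v ∉ g) (hvu : v ≠ u) :
    (u ∈ g → x ∉ g → ∀ y ∈ f, y ≠ v → y ∈ g) ∧ (u ∉ g → x ∈ g → ∀ y ∈ f, y ≠ v → y ∈ g) ∧
    (u ∉ g → (g ∩ f).card ≠ 1) := by
  obtain ⟨h1, h2, h3⟩ := mem_Xk.1 hx
  have hef : ∀ y ∈ ({v, u, x} : Finset V12), y ∈ f → y = v := by
    intro y hy hyf
    simp only [Finset.mem_insert, Finset.mem_singleton] at hy
    rcases hy with rfl | rfl | rfl
    · rfl
    · exact (huf hyf).elim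
    · exact (hxf hyf).elim
  refine ⟨fun hu hxg => ?_, fun hu hxg => ?_, fun hu hc => ?_⟩
  · refine fact1 hU hP hC (a := u) h3 hf hg (by simp) hvf hvg hef hu (by simp) ?_
    intro y hy hy'
    simp only [Finset.mem_insert, Finset.mem_singleton] at hy'
    rcases hy' with rfl | rfl | rfl
    · exact (hvg hy).elim
    · rfl
    · exact (hxg hy).elim
  · refine fact1 hU hP hC (a := x) h3 hf hg (by simp) hvf hvg hef hxg (by simp) ?_
    intro y hy hy'
    simp only [Finset.mem_insert, Finset.mem_singleton] at hy'
    rcases hy' with rfl | rfl | rfl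
    · exact (hvg hy).elim
    · exact (hu hy).elim
    · rfl
  · obtain ⟨a, ha⟩ := Finset.card_eq_one.1 hc
    have ha' : a ∈ g ∩ f := by rw [ha]; simp
    rw [Finset.mem_inter] at ha'
    apply hu
    refine fact1 hU hP hC (a := a) hf h3 hg hvf (by simp) hvg (fun y h h' => hef y h' h) ha'.1 ha'.2 ?_ u (by simp) hvu.symm
    intro y hy hy'
    have : y ∈ g ∩ f := Finset.mem_inter.2 ⟨hy, hy'⟩
    rw [ha] at this
    simpa using this

theorem exists_X {X S : Finset V12} (h : S.card < X.card) : ∃ x ∈ X, x ∉ S :=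
  Finset.exists_mem_notMem_of_card_lt_card h

/-- B0 -/
theorem caseB0 (hU : U3 E) (hP : PF E) {v u : V12} (hvu : v ≠ u)
    (hD : 7 ≤ (Lk E v).card) (hmax : (Lk E u).card ≤ (Lk E v).card) (hF : Fk E v u = ∅) :
    E.card ≤ 24 := by
  have h1 := Lk_le hU hvu
  rw [hF, Finset.card_empty] at h1
  have h2 := Xk_le (E := E) hvu
  have hsub : Lk E v ⊆ Lk E u := by
    intro e he
    simp only [Lk, Finset.mem_filter] at he ⊢
    refine ⟨he.1, ?_⟩
    by_contra hu
    have : e ∈ Fk E v u := by simp [Fk, he, hu]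
    rw [hF] at this
    exact absurd this (Finset.notMem_empty _)
  have heq := Finset.eq_of_subset_of_card_le hsub hmax
  have hF' : Fk E u v = ∅ := by
    rw [Finset.eq_empty_iff_forall_notMem]
    intro e he
    simp only [Fk, Finset.mem_filter] at he
    have : e ∈ Lk E u := by simp [Lk, he]
    rw [← heq] at this
    simp only [Lk, Finset.mem_filter] at this
    exact he.2.2 this.2
  have h3 := E_le (E := E) (v := v) (u := u)
  rw [hF', Finset.card_empty] at h3
  have h4 : (Tk E v u).card ≤ 12 := by
    have hT : ∀ g ∈ Tk E v u, g ∈ E ∧ v ∉ g ∧ u ∉ g := by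
      intro g hg; simpa [Tk] using hg
    have no1 : ∀ g ∈ Tk E v u, ∀ g' ∈ Tk E v u, (g ∩ g').card = 1 →
        ∀ x ∈ Xk E v u, x ∈ g → x ∉ g' → False := by
      intro g hg g' hg' hc x hx hxg hxg'
      obtain ⟨hgE, hvg, hug⟩ := hT g hg
      obtain ⟨hgE', hvg', hug'⟩ := hT g' hg'
      obtain ⟨_, _, hx3⟩ := mem_Xk.1 hx
      have e1 : ({v, u, x} ∩ g : Finset V12) = {x} := by
        ext y
        simp only [Finset.mem_inter, Finset.mem_insert, Finset.mem_singleton]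
        constructor
        · rintro ⟨rfl | rfl | rfl, h⟩
          · exact (hvg h).elim
          · exact (hug h).elim
          · rfl
        · rintro rfl; exact ⟨Or.inr (Or.inr rfl), hxg⟩
      have e2 : ({v, u, x} ∩ g' : Finset V12) = ∅ := by
        ext y
        simp only [Finset.mem_inter, Finset.mem_insert, Finset.mem_singleton, Finset.notMem_empty, iff_false]
        rintro ⟨rfl | rfl | rfl, h⟩
        · exact hvg' h
        · exact hug' h
        · exact hxg' h
      exact P3_false hP hx3 hgE hgE' (by simp [P3, e1, e2, hc])
    apply oddtown
    · exact fun g hg => hU g (hT g hg).1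
    · intro g hg g' hg' hne
      have hg3 := hU g (hT g hg).1
      have hg3' := hU g' (hT g' hg').1
      have hle : (g ∩ g').card ≤ 3 := hg3 ▸ Finset.card_le_card Finset.inter_subset_left
      have hn3 : (g ∩ g').card ≠ 3 := by
        intro h
        have := Finset.eq_of_subset_of_card_le (Finset.inter_subset_left (s₁ := g) (s₂ := g')) (by omega)
        have h' := Finset.eq_of_subset_of_card_le (Finset.inter_subset_right (s₁ := g) (s₂ := g')) (by omega)
        exact hne (this.symm.trans h')
      have hn1 : (g ∩ g').card ≠ 1 := by
        intro hc
        have hcu : (g \ g').card + (g ∩ g').card = g.card := Finset.card_sdiff_add_card_inter _ _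
        have hcu' : (g' \ g).card + (g' ∩ g).card = g'.card := Finset.card_sdiff_add_card_inter _ _
        rw [Finset.inter_comm] at hcu'
        have hdis : Disjoint (g \ g') (g' \ g) := by
          rw [Finset.disjoint_left]; intro x hx hx'
          simp only [Finset.mem_sdiff] at hx hx'; exact hx.2 hx'.1
        have h4 := Finset.card_union_of_disjoint hdis
        have : ∃ x ∈ Xk E v u, x ∈ (g \ g') ∪ (g' \ g) := by
          by_contra hcon
          push Not at hcon
          have hd2 : Disjoint (Xk E v u) ((g \ g') ∪ (g' \ g)) := Finset.disjoint_left.2 hcon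
          have h5 := Finset.card_union_of_disjoint hd2
          have : Xk E v u ∪ ((g \ g') ∪ (g' \ g)) ⊆ (Finset.univ.erase v).erase u := by
            intro x hx
            simp only [Finset.mem_union, Finset.mem_sdiff] at hx
            simp only [Finset.mem_erase, Finset.mem_univ, and_true]
            rcases hx with hx | hx | hx
            · exact ⟨(mem_Xk.1 hx).2.1, (mem_Xk.1 hx).1⟩
            · exact ⟨fun h => (hT g hg).2.2 (h ▸ hx.1), fun h => (hT g hg).2.1 (h ▸ hx.1)⟩
            · exact ⟨fun h => (hT g' hg').2.2 (h ▸ hx.1), fun h => (hT g' hg').2.1 (h ▸ hx.1)⟩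
          have h6 := Finset.card_le_card this
          rw [Finset.card_erase_of_mem (by simp [hvu.symm]), Finset.card_erase_of_mem (by simp)] at h6
          simp only [Finset.card_univ, Fintype.card_fin] at h6
          omega
        obtain ⟨x, hx, hx'⟩ := this
        simp only [Finset.mem_union, Finset.mem_sdiff] at hx'
        rcases hx' with hx' | hx'
        · exact no1 g hg g' hg' hc x hx hx'.1 hx'.2
        · exact no1 g' hg' g hg (by rw [Finset.inter_comm]; exact hc) x hx hx'.1 hx'.2
      have : (g ∩ g').card = 0 ∨ (g ∩ g').card = 2 := by omega
      rcases this with h | h <;> rw [h] <;> decide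
  omega

end CB

section CB2
variable {E : Finset (Finset V12)}

theorem mem_Tk {v u : V12} {g : Finset V12} : g ∈ Tk E v u ↔ g ∈ E ∧ v ∉ g ∧ u ∉ g := by simp [Tk]
theorem mem_Fk {v u : V12} {g : Finset V12} : g ∈ Fk E v u ↔ g ∈ E ∧ v ∈ g ∧ u ∉ g := by simp [Fk]

theorem f2 (hU : U3 E) {v u : V12} {f : Finset V12} (hf : f ∈ Fk E v u) : (f.erase v).card = 2 := by
  obtain ⟨h1, h2, _⟩ := mem_Fk.1 hf
  rw [Finset.card_erase_of_mem h2, hU f h1]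

theorem Xsep {v u : V12} {S f : Finset V12} (h : (S ∪ f.erase v).card < (Xk E v u).card) :
    ∃ x ∈ Xk E v u, x ∉ S ∧ x ∉ f := by
  obtain ⟨x, hx, hxS⟩ := exists_X h
  simp only [Finset.mem_union, Finset.mem_erase, not_or, not_and] at hxS
  exact ⟨x, hx, hxS.1, hxS.2 (mem_Xk.1 hx).1⟩

theorem bT (hU : U3 E) (hP : PF E) (hC : CFr E) {v u : V12} (hvu : v ≠ u)
    (hX : 3 ≤ (Xk E v u).card) {f g : Finset V12} (hf : f ∈ Fk E v u) (hg : g ∈ Tk E v u)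
    (h : ∃ y ∈ g, y ∈ f ∨ y ∈ Xk E v u) : f.erase v ⊆ g := by
  have hf2 := f2 hU hf
  obtain ⟨hfE, hvf, huf⟩ := mem_Fk.1 hf
  obtain ⟨hgE, hvg, hug⟩ := mem_Tk.1 hg
  by_cases hgf : ∃ y ∈ g, y ∈ f
  · obtain ⟨x, hx, -, hxf⟩ := Xsep (E := E) (v := v) (u := u) (S := ∅) (f := f) (by simp; omega)
    have hn := (bkey hU hP hC hx hfE hvf huf hxf hgE hvg hvu).2.2 hug
    have hn0 : (g ∩ f).card ≠ 0 := by
      obtain ⟨y, h1, h2⟩ := hgf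
      exact Finset.card_ne_zero_of_mem (Finset.mem_inter.2 ⟨h1, h2⟩)
    have hs : g ∩ f ⊆ f.erase v := by
      intro y hy
      rw [Finset.mem_inter] at hy
      exact Finset.mem_erase.2 ⟨fun h => hvg (h ▸ hy.1), hy.2⟩
    have := Finset.eq_of_subset_of_card_le hs (by omega)
    rw [← this]
    exact Finset.inter_subset_left
  · push Not at hgf
    obtain ⟨y, hyg, hy⟩ := h
    have hyf := hgf y hyg
    have hyX := hy.resolve_left hyf
    intro z hz
    rw [Finset.mem_erase] at hz
    exact (bkey hU hP hC hyX hfE hvf huf hyf hgE hvg hvu).2.1 hug hyg z hz.2 hz.1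

theorem compl_card {v u : V12} (hvu : v ≠ u) (X : Finset V12) (hv : v ∉ X) (hu : u ∉ X) :
    (Finset.univ \ (insert v (insert u X))).card + X.card = 10 := by
  rw [Finset.card_sdiff_of_subset (Finset.subset_univ _), Finset.card_insert_of_notMem (by simp [hvu, hv]),
    Finset.card_insert_of_notMem hu]
  have : (insert v (insert u X)).card ≤ 12 := by
    simpa using Finset.card_le_univ (insert v (insert u X))
  rw [Finset.card_insert_of_notMem (by simp [hvu, hv]), Finset.card_insert_of_notMem hu] at this
  simp only [Finset.card_univ, Fintype.card_fin]
  omega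

theorem vX {v u : V12} : v ∉ Xk E v u := fun h => (mem_Xk.1 h).1 rfl
theorem uX {v u : V12} : u ∉ Xk E v u := fun h => (mem_Xk.1 h).2.1 rfl

theorem caseB1 (hU : U3 E) (hP : PF E) (hC : CFr E) {v u : V12} (hvu : v ≠ u)
    (hD : 7 ≤ (Lk E v).card) (hF : (Fk E v u).card = 1) : E.card ≤ 24 := by
  have h1 := Lk_le hU hvu
  have h2 := Xk_le (E := E) hvu
  have h3 := E_le (E := E) (v := v) (u := u)
  obtain ⟨f, hFf⟩ := Finset.card_eq_one.1 hF
  have hf : f ∈ Fk E v u := by rw [hFf]; simp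
  have hf2 := f2 hU hf
  obtain ⟨hfE, hvf, huf⟩ := mem_Fk.1 hf
  have h4 : (Fk E u v).card ≤ 1 := by
    have : Fk E u v ⊆ {insert u (f.erase v)} := by
      intro g hg
      have hg2 := f2 hU hg
      obtain ⟨hgE, hug, hvg⟩ := mem_Fk.1 hg
      have hc := Finset.card_union_le (g.erase u) (f.erase v)
      obtain ⟨x, hx, hxg, hxf⟩ := Xsep (E := E) (v := v) (u := u) (S := g.erase u) (f := f) (by omega)
      have hxg' : x ∉ g := fun h => hxg (Finset.mem_erase.2 ⟨(mem_Xk.1 hx).2.1, h⟩)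
      have := (bkey hU hP hC hx hfE hvf huf hxf hgE hvg hvu).1 hug hxg'
      rw [Finset.mem_singleton]
      symm
      apply Finset.eq_of_subset_of_card_le
      · intro y hy
        rw [Finset.mem_insert, Finset.mem_erase] at hy
        rcases hy with rfl | hy
        · exact hug
        · exact this y hy.2 hy.1
      · rw [Finset.card_insert_of_notMem (by simp [huf]), hf2, hU g hgE]
    simpa using Finset.card_le_card this
  have h5 : (Tk E v u).card ≤ 12 := by
    have : Tk E v u ⊆ (Finset.univ \ insert v (insert u (f.erase v))).image (fun w => insert w (f.erase v)) ∪
        (Finset.univ \ insert v (insert u (Xk E v u))).powersetCard 3 := by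
      intro g hg
      obtain ⟨hgE, hvg, hug⟩ := mem_Tk.1 hg
      by_cases h : ∃ y ∈ g, y ∈ f ∨ y ∈ Xk E v u
      · have hs := bT hU hP hC hvu (by omega) hf hg h
        apply Finset.mem_union_left
        have hc : (g \ f.erase v).card = 1 := by
          rw [Finset.card_sdiff_of_subset hs, hU g hgE, hf2]
        obtain ⟨w, hw⟩ := Finset.card_eq_one.1 hc
        have hwm : w ∈ g \ f.erase v := by rw [hw]; simp
        rw [Finset.mem_sdiff] at hwm
        refine Finset.mem_image.2 ⟨w, ?_, ?_⟩
        · simp only [Finset.mem_sdiff, Finset.mem_univ, true_and, Finset.mem_insert, not_or]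
          exact ⟨fun h => hvg (h ▸ hwm.1), fun h => hug (h ▸ hwm.1), hwm.2⟩
        · show insert w (f.erase v) = g
          rw [Finset.insert_eq, ← hw, Finset.sdiff_union_of_subset hs]
      · push Not at h
        apply Finset.mem_union_right
        rw [Finset.mem_powersetCard]
        refine ⟨fun y hy => ?_, hU g hgE⟩
        simp only [Finset.mem_sdiff, Finset.mem_univ, true_and, Finset.mem_insert, not_or]
        exact ⟨fun h => hvg (h ▸ hy), fun h => hug (h ▸ hy), (h y hy).2⟩
    have hc := (Finset.card_le_card this).trans (Finset.card_union_le _ _)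
    have hi := Finset.card_image_le (s := Finset.univ \ insert v (insert u (f.erase v))) (f := fun w => insert w (f.erase v))
    have c1 := compl_card hvu (f.erase v) (by simp) (by simp [huf])
    have c2 := compl_card hvu (Xk E v u) vX uX
    rw [Finset.card_powersetCard] at hc
    have : (Finset.univ \ insert v (insert u (Xk E v u))).card.choose 3 ≤ 4 :=
      le_trans (Nat.choose_le_choose 3 (show _ ≤ 4 by omega)) (by decide)
    omega
  omega

theorem caseB2 (hU : U3 E) (hP : PF E) (hC : CFr E) {v u : V12} (hvu : v ≠ u)
    (hD : 7 ≤ (Lk E v).card) (hF : 2 ≤ (Fk E v u).card) {R : Finset V12} (hR : R.card = 3)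
    (huR : u ∉ R) (hvR : v ∉ R) (hFR : ∀ f ∈ Fk E v u, f ⊆ insert v R) :
    E.card ≤ 24 ∨ K66s E := by
  have h1 := Lk_le hU hvu
  have h2 := Xk_le (E := E) hvu
  have h3 := E_le (E := E) (v := v) (u := u)
  have hsub : ∀ f ∈ Fk E v u, f.erase v ⊆ R := by
    intro f hf y hy
    rw [Finset.mem_erase] at hy
    exact (Finset.mem_insert.1 (hFR f hf hy.2)).resolve_left hy.1
  have hF3 : (Fk E v u).card ≤ 3 := by
    have : Fk E v u ⊆ (R.powersetCard 2).image (insert v) := by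
      intro f hf
      refine Finset.mem_image.2 ⟨f.erase v, Finset.mem_powersetCard.2 ⟨hsub f hf, f2 hU hf⟩, ?_⟩
      exact Finset.insert_erase (mem_Fk.1 hf).2.1
    have h := (Finset.card_le_card this).trans Finset.card_image_le
    rw [Finset.card_powersetCard, hR] at h
    exact h
  have hX : 4 ≤ (Xk E v u).card := by omega
  obtain ⟨f, hf, f', hf', hne⟩ := Finset.one_lt_card.1 hF
  have hf2 := f2 hU hf
  have hf2' := f2 hU hf'
  have hne' : f.erase v ≠ f'.erase v := by
    intro h
    apply hne
    rw [← Finset.insert_erase (mem_Fk.1 hf).2.1, h, Finset.insert_erase (mem_Fk.1 hf').2.1]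
  obtain ⟨hfE, hvf, huf⟩ := mem_Fk.1 hf
  obtain ⟨hfE', hvf', huf'⟩ := mem_Fk.1 hf'
  have hun : f.erase v ∪ f'.erase v = R := by
    apply Finset.eq_of_subset_of_card_le (Finset.union_subset (hsub f hf) (hsub f' hf'))
    by_contra hlt
    have e1 := Finset.eq_of_subset_of_card_le (Finset.subset_union_left (s₁ := f.erase v) (s₂ := f'.erase v)) (by omega)
    have e2 := Finset.eq_of_subset_of_card_le (Finset.subset_union_right (s₁ := f.erase v) (s₂ := f'.erase v)) (by omega)
    exact hne' (e1.trans e2.symm)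
  have hi1 : (f.erase v ∩ f'.erase v).card = 1 := by
    have := Finset.card_union_add_card_inter (f.erase v) (f'.erase v)
    rw [hun] at this
    omega
  -- edges through u avoiding v
  have aux : ∀ g ∈ Fk E u v, ∀ f ∈ Fk E v u, ¬ (f.erase v = g.erase u) → Xk E v u ⊆ f.erase v ∪ g.erase u := by
    intro g hg f hf hfg x hx
    by_contra hxn
    simp only [Finset.mem_union, Finset.mem_erase, not_or, not_and] at hxn
    obtain ⟨hfE, hvf, huf⟩ := mem_Fk.1 hf
    obtain ⟨hgE, hug, hvg⟩ := mem_Fk.1 hg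
    have := (bkey hU hP hC hx hfE hvf huf (hxn.1 (mem_Xk.1 hx).1) hgE hvg hvu).1 hug (hxn.2 (mem_Xk.1 hx).2.1)
    apply hfg
    apply Finset.eq_of_subset_of_card_le
    · intro y hy
      rw [Finset.mem_erase] at hy
      exact Finset.mem_erase.2 ⟨fun h => huf (h ▸ hy.2), this y hy.2 hy.1⟩
    · rw [f2 hU hg, f2 hU hf]
  have h4 : Fk E u v = ∅ := by
    rw [Finset.eq_empty_iff_forall_notMem]
    intro g hg
    have hg2 := f2 hU hg
    have a1 := aux g hg f hf
    have a2 := aux g hg f' hf'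
    by_cases e1 : f.erase v = g.erase u
    · have := a2 (fun h => hne' (e1.trans h.symm))
      rw [← e1, Finset.union_comm, hun] at this
      have := Finset.card_le_card this
      omega
    by_cases e2 : f'.erase v = g.erase u
    · have := a1 e1
      rw [← e2, hun] at this
      have := Finset.card_le_card this
      omega
    have b1 := a1 e1
    have b2 := a2 e2
    have hs : Xk E v u ⊆ (f.erase v ∩ f'.erase v) ∪ g.erase u := by
      intro x hx
      have c1 := b1 hx
      have c2 := b2 hx
      simp only [Finset.mem_union, Finset.mem_inter] at c1 c2 ⊢
      tauto
    have := (Finset.card_le_card hs).trans (Finset.card_union_le _ _)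
    omega
  have hT : ∀ g ∈ Tk E v u, g = R ∨ g ⊆ (Finset.univ \ insert v (insert u (Xk E v u))) \ R := by
    intro g hg
    obtain ⟨hgE, hvg, hug⟩ := mem_Tk.1 hg
    by_cases h : ∃ y ∈ g, y ∈ R ∨ y ∈ Xk E v u
    · left
      have hs : f.erase v ⊆ g ∧ f'.erase v ⊆ g := by
        obtain ⟨y, hyg, hy⟩ := h
        rcases hy with hy | hy
        · rw [← hun, Finset.mem_union] at hy
          obtain ⟨z, hz⟩ := Finset.card_pos.1 (show 0 < (f.erase v ∩ f'.erase v).card by omega)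
          simp only [Finset.mem_inter, Finset.mem_erase] at hz hy
          rcases hy with hy | hy
          · have := bT hU hP hC hvu (by omega) hf hg ⟨y, hyg, Or.inl hy.2⟩
            exact ⟨this, bT hU hP hC hvu (by omega) hf' hg ⟨z, this (Finset.mem_erase.2 hz.1), Or.inl hz.2.2⟩⟩
          · have := bT hU hP hC hvu (by omega) hf' hg ⟨y, hyg, Or.inl hy.2⟩
            exact ⟨bT hU hP hC hvu (by omega) hf hg ⟨z, this (Finset.mem_erase.2 hz.2), Or.inl hz.1.2⟩, this⟩
        · exact ⟨bT hU hP hC hvu (by omega) hf hg ⟨y, hyg, Or.inr hy⟩,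
            bT hU hP hC hvu (by omega) hf' hg ⟨y, hyg, Or.inr hy⟩⟩
      have := Finset.union_subset hs.1 hs.2
      rw [hun] at this
      exact (Finset.eq_of_subset_of_card_le this (by rw [hU g hgE, hR])).symm
    · right
      push Not at h
      intro y hy
      simp only [Finset.mem_sdiff, Finset.mem_univ, true_and, Finset.mem_insert, not_or]
      exact ⟨⟨fun h => hvg (h ▸ hy), fun h => hug (h ▸ hy), (h y hy).2⟩, (h y hy).1⟩
  have c2 := compl_card hvu (Xk E v u) vX uX
  rw [h4, Finset.card_empty] at h3
  by_cases hY : ((Finset.univ \ insert v (insert u (Xk E v u))) \ R).card ≤ 5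
  · left
    have h5 : (Tk E v u).card ≤ 11 := by
      have : Tk E v u ⊆ insert R (((Finset.univ \ insert v (insert u (Xk E v u))) \ R).powersetCard 3) := by
        intro g hg
        rw [Finset.mem_insert, Finset.mem_powersetCard]
        rcases hT g hg with h | h
        · exact Or.inl h
        · exact Or.inr ⟨h, hU g (mem_Tk.1 hg).1⟩
      have hc := (Finset.card_le_card this).trans (Finset.card_insert_le _ _)
      rw [Finset.card_powersetCard] at hc
      have : ((Finset.univ \ insert v (insert u (Xk E v u))) \ R).card.choose 3 ≤ 10 :=
        le_trans (Nat.choose_le_choose 3 hY) (by decide)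
      omega
    omega
  · right
    have hle := Finset.card_le_card (Finset.sdiff_subset (s := (Finset.univ \ insert v (insert u (Xk E v u)))) (t := R))
    have heq := Finset.eq_of_subset_of_card_le (Finset.sdiff_subset (s := (Finset.univ \ insert v (insert u (Xk E v u)))) (t := R)) (by omega)
    have hRU : R ⊆ insert v (insert u (Xk E v u)) := by
      intro y hy
      by_contra hn
      have : y ∈ (Finset.univ \ insert v (insert u (Xk E v u))) := by simp only [Finset.mem_sdiff, Finset.mem_univ, true_and]; exact hn
      rw [← heq, Finset.mem_sdiff] at this
      exact this.2 hy
    refine ⟨insert v (insert u (Xk E v u)), ?_, ?_⟩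
    · rw [Finset.card_insert_of_notMem (by simp [hvu, vX]), Finset.card_insert_of_notMem uX]
      omega
    · intro e he
      by_cases hv : v ∈ e
      · left
        by_cases hu : u ∈ e
        · obtain ⟨x, h1, h2, rfl⟩ := third hU hvu he hv hu
          have : x ∈ Xk E v u := mem_Xk.2 ⟨h1, h2, he⟩
          intro y hy
          simp only [Finset.mem_insert, Finset.mem_singleton] at hy ⊢
          rcases hy with rfl | rfl | rfl
          · exact Or.inl rfl
          · exact Or.inr (Or.inl rfl)
          · exact Or.inr (Or.inr this)
        · have := hFR e (mem_Fk.2 ⟨he, hv, hu⟩)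
          exact this.trans (Finset.insert_subset (Finset.mem_insert_self _ _) hRU)
      · have hu : u ∉ e := by
          intro hu
          have : e ∈ Fk E u v := mem_Fk.2 ⟨he, hu, hv⟩
          rw [h4] at this
          exact absurd this (Finset.notMem_empty _)
        rcases hT e (mem_Tk.2 ⟨he, hv, hu⟩) with rfl | h
        · exact Or.inl hRU
        · right
          rw [Finset.eq_empty_iff_forall_notMem]
          intro y hy
          rw [Finset.mem_inter] at hy
          have := h hy.1
          rw [Finset.mem_sdiff, Finset.mem_sdiff] at this
          exact this.1.2 hy.2

end CB2

section CB3
variable {E : Finset (Finset V12)}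

theorem caseB (hU : U3 E) (hP : PF E) (hC : CFr E) {v : V12}
    (hD : 7 ≤ (Lk E v).card) (hmax : ∀ u, (Lk E u).card ≤ (Lk E v).card)
    {e h : Finset V12} (he : e ∈ E) (hve : v ∈ e) (hh : h ∈ E) (hvh : v ∉ h)
    (hc : (h ∩ e).card = 1) : E.card ≤ 24 ∨ K66s E := by
  obtain ⟨a, ha⟩ := Finset.card_eq_one.1 hc
  have ham : a ∈ h ∩ e := by rw [ha]; simp
  rw [Finset.mem_inter] at ham
  obtain ⟨hah, hae⟩ := ham
  have hva : v ≠ a := fun h' => hvh (h' ▸ hah)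
  obtain ⟨b, hbv, hba, rfl⟩ := third hU hva he hve hae
  have hbh : b ∉ h := by
    intro hb
    have : b ∈ h ∩ {v, a, b} := Finset.mem_inter.2 ⟨hb, by simp⟩
    rw [ha, Finset.mem_singleton] at this
    exact hba this
  -- Claim 1
  have claim : ∀ x, x ≠ v → x ≠ a → x ∉ h → {v, a, x} ∈ E → ∀ f ∈ E, v ∈ f → a ∉ f → x ∉ f →
      f = insert v (h.erase a) := by
    intro x hxv hxa hxh hx f hf hvf haf hxf
    have := fact1 hU hP hC (a := a) hx hf hh (by simp) hvf hvh
      (by intro y hy hyf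
          simp only [Finset.mem_insert, Finset.mem_singleton] at hy
          rcases hy with rfl | rfl | rfl
          · rfl
          · exact (haf hyf).elim
          · exact (hxf hyf).elim) hah (by simp)
      (by intro y hyh hy
          simp only [Finset.mem_insert, Finset.mem_singleton] at hy
          rcases hy with rfl | rfl | rfl
          · exact (hvh hyh).elim
          · rfl
          · exact (hxh hyh).elim)
    apply Finset.eq_of_subset_of_card_le
    · intro y hy
      rw [Finset.mem_insert, Finset.mem_erase]
      by_cases hyv : y = v
      · exact Or.inl hyv
      · exact Or.inr ⟨fun h' => haf (h' ▸ hy), this y hy hyv⟩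
    · rw [hU f hf]
      refine (Finset.card_insert_le _ _).trans ?_
      rw [Finset.card_erase_of_mem hah, hU h hh]
  by_cases hI : ∃ x, x ≠ v ∧ x ≠ a ∧ x ≠ b ∧ x ∉ h ∧ {v, a, x} ∈ E
  · obtain ⟨x, hxv, hxa, hxb, hxh, hx⟩ := hI
    by_cases hbx : {v, b, x} ∈ E
    · exfalso
      have : Lk E v ⊆ insert {v, b, x} (insert (insert v (h.erase a))
          ((insert b (insert x (h.erase a))).image (fun y => {v, a, y}))) := by
        intro f hf
        simp only [Lk, Finset.mem_filter] at hf
        rw [Finset.mem_insert, Finset.mem_insert]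
        by_cases haf : a ∈ f
        · right; right
          obtain ⟨y, hyv, hya, rfl⟩ := third hU hva hf.1 hf.2 haf
          refine Finset.mem_image.2 ⟨y, ?_, rfl⟩
          by_contra hy
          simp only [Finset.mem_insert, Finset.mem_erase, not_or, not_and] at hy
          have := claim y hyv hya (hy.2.2 hya) hf.1 _ hbx (by simp)
            (by simp only [Finset.mem_insert, Finset.mem_singleton, not_or]; exact ⟨hva.symm, hba.symm, hxa.symm⟩)
            (by simp only [Finset.mem_insert, Finset.mem_singleton, not_or]; exact ⟨hyv, hy.1, hy.2.1⟩)
          have hb' : b ∈ insert v (h.erase a) := this ▸ (by simp)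
          rw [Finset.mem_insert, Finset.mem_erase] at hb'
          rcases hb' with h' | h'
          · exact hbv h'
          · exact hbh h'.2
        · by_cases hbf : b ∈ f
          · by_cases hxf : x ∈ f
            · left
              obtain ⟨y, hyv, hyb, rfl⟩ := third hU hbv.symm hf.1 hf.2 hbf
              simp only [Finset.mem_insert, Finset.mem_singleton] at hxf
              rcases hxf with h' | h' | h'
              · exact (hxv h').elim
              · exact (hxb h').elim
              · rw [h']
            · right; left
              exact claim x hxv hxa hxh hx f hf.1 hf.2 haf hxf
          · right; left
            exact claim b hbv hba hbh he f hf.1 hf.2 haf hbf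
      have c1 := (Finset.card_le_card this).trans ((Finset.card_insert_le _ _).trans
        (Nat.add_le_add_right ((Finset.card_insert_le _ _).trans (Nat.add_le_add_right Finset.card_image_le _)) _))
      have c2 := Finset.card_insert_le b (insert x (h.erase a))
      have c3 := Finset.card_insert_le x (h.erase a)
      have c4 : (h.erase a).card = 2 := by rw [Finset.card_erase_of_mem hah, hU h hh]
      omega
    · left
      have : Fk E v a ⊆ {insert v (h.erase a)} := by
        intro f hf
        obtain ⟨hfE, hvf, haf⟩ := mem_Fk.1 hf
        rw [Finset.mem_singleton]
        by_cases hbf : b ∈ f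
        · by_cases hxf : x ∈ f
          · exfalso
            obtain ⟨y, hyv, hyb, rfl⟩ := third hU hbv.symm hfE hvf hbf
            simp only [Finset.mem_insert, Finset.mem_singleton] at hxf
            rcases hxf with h' | h' | h'
            · exact (hxv h').elim
            · exact (hxb h').elim
            · exact hbx (h' ▸ hfE)
          · exact claim x hxv hxa hxh hx f hfE hvf haf hxf
        · exact claim b hbv hba hbh he f hfE hvf haf hbf
      have hle := Finset.card_le_card this
      rw [Finset.card_singleton] at hle
      rcases Nat.le_one_iff_eq_zero_or_eq_one.1 hle with h0 | h0
      · exact caseB0 hU hP hva hD (hmax a) (Finset.card_eq_zero.1 h0)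
      · exact caseB1 hU hP hC hva hD h0
  · push Not at hI
    rcases Nat.lt_or_ge (Fk E v b).card 2 with hlt | hge
    · left
      rcases Nat.le_one_iff_eq_zero_or_eq_one.1 (Nat.le_of_lt_succ hlt) with h0 | h0
      · exact caseB0 hU hP hbv.symm hD (hmax b) (Finset.card_eq_zero.1 h0)
      · exact caseB1 hU hP hC hbv.symm hD h0
    · refine caseB2 hU hP hC hbv.symm hD hge (hU h hh) hbh hvh ?_
      intro f hf
      obtain ⟨hfE, hvf, hbf⟩ := mem_Fk.1 hf
      by_cases haf : a ∈ f
      · obtain ⟨y, hyv, hya, rfl⟩ := third hU hva hfE hvf haf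
        have hyb : y ≠ b := by
          rintro rfl; exact hbf (by simp)
        have hyh : y ∈ h := by
          by_contra hyh
          exact hI y hyv hya hyb hyh hfE
        intro z hz
        simp only [Finset.mem_insert, Finset.mem_singleton] at hz ⊢
        rcases hz with rfl | rfl | rfl
        · exact Or.inl rfl
        · exact Or.inr hah
        · exact Or.inr hyh
      · rw [claim b hbv hba hbh he f hfE hvf haf hbf]
        exact Finset.insert_subset_insert _ (Finset.erase_subset _ _)

end CB3

section CA
variable {E : Finset (Finset V12)}

def starS (E : Finset (Finset V12)) : Prop := ∃ v : V12, ∀ e ∈ E, v ∈ e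
def cometS (E : Finset (Finset V12)) : Prop :=
  ∃ (v : V12) (B : Finset V12), B.card = 3 ∧ v ∉ B ∧ ∀ e ∈ E, e ⊆ insert v B ∨ (v ∈ e ∧ e ∩ B = ∅)
def ExtS (E : Finset (Finset V12)) : Prop :=
  ∃ (v : V12) (I : Finset V12), v ∉ I ∧ (I.card = 4 ∨ I.card = 5) ∧ ∀ e ∈ E, e ⊆ I ∨ (v ∈ e ∧ e ∩ I = ∅)

theorem numA (q n n2 n3 l TN T L r m : ℕ) (hq : 3 ≤ q) (hq' : q ≤ 11) (hn : 2 ≤ n) (hn' : n ≤ q)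
    (hr : r = q - n) (hm : m = max 1 r)
    (h1 : n2 + n3 = n) (h2 : 2 * l ≤ n2 + 2 * n3) (h3 : 2 * TN ≤ m * n2 + n3)
    (h4 : T ≤ TN + r.choose 3) (h5 : 3 * T ≤ n * m + r * T) (h6 : 2 ≤ T) (h7 : 7 ≤ L)
    (h8 : L ≤ (11 - q).choose 2 + l) : L + T ≤ 24 := by
  subst hr hm
  interval_cases q <;> interval_cases n <;>
    simp only [Nat.choose, Nat.reduceSub, Nat.reduceLeDiff, max_eq_left, max_eq_right, sup_of_le_left, sup_of_le_right] at h3 h4 h5 h8 <;> omega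

theorem caseA (hU : U3 E) {v : V12}
    (hD : 7 ≤ (Lk E v).card)
    (hA : ∀ e ∈ E, v ∈ e → ∀ h ∈ E, v ∉ h → (h ∩ e).card ≠ 1)
    (hs : ¬ starS E) (hco : ¬ cometS E) (hk : ¬ K66s E) :
    E.card ≤ 24 ∨ (E.card ≤ 25 ∧ ExtS E) := by
  set L := Lk E v with hL
  set T := E.filter (fun e => v ∉ e) with hT
  set Q := T.biUnion id with hQ
  have mL : ∀ e, e ∈ L ↔ e ∈ E ∧ v ∈ e := fun e => by simp [hL, Lk]
  have mT : ∀ e, e ∈ T ↔ e ∈ E ∧ v ∉ e := fun e => by simp [hT]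
  have mQ : ∀ x, x ∈ Q ↔ ∃ h ∈ T, x ∈ h := fun e => by simp [hQ]
  have hE : E.card = L.card + T.card := by
    rw [hL, hT, Lk]; exact (Finset.card_filter_add_card_filter_not _).symm
  have hvQ : v ∉ Q := by
    intro h
    obtain ⟨h', h1, h2⟩ := (mQ v).1 h
    exact ((mT _).1 h1).2 h2
  have TQ : ∀ h ∈ T, h ⊆ Q := fun h hh x hx => (mQ x).2 ⟨h, hh, hx⟩
  have hlink : ∀ e ∈ L, ∀ h ∈ T, ∀ y ∈ e, y ∈ h → ∀ z ∈ e, z ≠ v → z ∈ h := by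
    intro e he h hh y hye hyh z hz hzv
    have he' := (mL e).1 he
    have hh' := (mT h).1 hh
    have h1 := hA e he'.1 he'.2 h hh'.1 hh'.2
    have h0 : (h ∩ e).card ≠ 0 := Finset.card_ne_zero_of_mem (Finset.mem_inter.2 ⟨hyh, hye⟩)
    have hsub : h ∩ e ⊆ e.erase v := by
      intro x hx
      rw [Finset.mem_inter] at hx
      exact Finset.mem_erase.2 ⟨fun h' => hh'.2 (h' ▸ hx.1), hx.2⟩
    have := Finset.eq_of_subset_of_card_le hsub (by rw [Finset.card_erase_of_mem he'.2, hU e he'.1]; omega)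
    have hz' : z ∈ h ∩ e := this ▸ Finset.mem_erase.2 ⟨hzv, hz⟩
    exact (Finset.mem_inter.1 hz').1
  have hT0 : T.Nonempty := by
    by_contra h0
    rw [Finset.not_nonempty_iff_eq_empty] at h0
    apply hs
    refine ⟨v, fun e he => ?_⟩
    by_contra hv
    have : e ∈ T := (mT e).2 ⟨he, hv⟩
    rw [h0] at this
    exact absurd this (Finset.notMem_empty _)
  have hT2 : 2 ≤ T.card := by
    by_contra hlt
    have h1 : T.card = 1 := by have := Finset.card_pos.2 hT0; omega
    obtain ⟨h0, hh0⟩ := Finset.card_eq_one.1 h1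
    have hm : h0 ∈ T := by rw [hh0]; simp
    apply hco
    refine ⟨v, h0, hU h0 ((mT h0).1 hm).1, ((mT h0).1 hm).2, fun e he => ?_⟩
    by_cases hv : v ∈ e
    · by_cases hmeet : ∃ y ∈ e, y ∈ h0
      · left
        obtain ⟨y, hy, hy'⟩ := hmeet
        intro z hz
        rw [Finset.mem_insert]
        by_cases hzv : z = v
        · exact Or.inl hzv
        · exact Or.inr (hlink e ((mL e).2 ⟨he, hv⟩) h0 hm y hy hy' z hz hzv)
      · right
        push Not at hmeet
        refine ⟨hv, Finset.eq_empty_iff_forall_notMem.2 fun x hx => ?_⟩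
        rw [Finset.mem_inter] at hx
        exact hmeet x hx.1 hx.2
    · left
      have : e ∈ T := (mT e).2 ⟨he, hv⟩
      rw [hh0, Finset.mem_singleton] at this
      rw [this]; exact Finset.subset_insert _ _
  have hq11 : Q.card ≤ 11 := by
    have : Q ⊆ Finset.univ.erase v := fun x hx => Finset.mem_erase.2 ⟨fun h => hvQ (h ▸ hx), Finset.mem_univ _⟩
    have h := Finset.card_le_card this
    rw [Finset.card_erase_of_mem (Finset.mem_univ _)] at h
    simpa using h
  have hq3 : 3 ≤ Q.card := by
    obtain ⟨h, hh⟩ := hT0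
    rw [← hU h ((mT h).1 hh).1]
    exact Finset.card_le_card (TQ h hh)
  -- L1
  have hL1 : (L.filter (fun e => e ∩ Q = ∅)).card ≤ (11 - Q.card).choose 2 := by
    have : L.filter (fun e => e ∩ Q = ∅) ⊆ ((Finset.univ \ insert v Q).powersetCard 2).image (insert v) := by
      intro e he
      rw [Finset.mem_filter, mL] at he
      refine Finset.mem_image.2 ⟨e.erase v, Finset.mem_powersetCard.2 ⟨?_, ?_⟩, Finset.insert_erase he.1.2⟩
      · intro x hx
        rw [Finset.mem_erase] at hx
        simp only [Finset.mem_sdiff, Finset.mem_univ, true_and, Finset.mem_insert, not_or]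
        refine ⟨hx.1, fun hxQ => ?_⟩
        have : x ∈ e ∩ Q := Finset.mem_inter.2 ⟨hx.2, hxQ⟩
        rw [he.2] at this
        exact absurd this (Finset.notMem_empty _)
      · rw [Finset.card_erase_of_mem he.1.2, hU e he.1.1]
    have h := (Finset.card_le_card this).trans Finset.card_image_le
    rw [Finset.card_powersetCard, Finset.card_sdiff_of_subset (Finset.subset_univ _),
      Finset.card_insert_of_notMem hvQ] at h
    simp only [Finset.card_univ, Fintype.card_fin] at h
    rwa [show 12 - (Q.card + 1) = 11 - Q.card by omega] at h
  have hLsplit : L.card = (L.filter (fun e => e ∩ Q = ∅)).card + (L.filter (fun e => ¬ e ∩ Q = ∅)).card :=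
    (Finset.card_filter_add_card_filter_not _).symm
  set L2 := L.filter (fun e => ¬ e ∩ Q = ∅) with hL2
  by_cases hn0 : L2 = ∅
  · -- n = 0
    have hd : ∀ e ∈ E, v ∈ e → e ∩ Q = ∅ := by
      intro e he hv
      by_contra hne
      have : e ∈ L2 := Finset.mem_filter.2 ⟨(mL e).2 ⟨he, hv⟩, hne⟩
      rw [hn0] at this
      exact absurd this (Finset.notMem_empty _)
    have hd' : ∀ e ∈ E, v ∉ e → e ⊆ Q := fun e he hv => TQ e ((mT e).2 ⟨he, hv⟩)
    have hTle : T.card ≤ Q.card.choose 3 := by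
      rw [← Finset.card_powersetCard]
      exact Finset.card_le_card fun h hh => Finset.mem_powersetCard.2 ⟨TQ h hh, hU h ((mT h).1 hh).1⟩
    rw [hn0, Finset.card_empty] at hLsplit
    have n3 : Q.card ≠ 3 := by
      intro h3
      apply hco
      refine ⟨v, Q, h3, hvQ, fun e he => ?_⟩
      by_cases hv : v ∈ e
      · exact Or.inr ⟨hv, hd e he hv⟩
      · exact Or.inl ((hd' e he hv).trans (Finset.subset_insert _ _))
    have n6 : Q.card ≠ 6 := by
      intro h6
      apply hk
      refine ⟨Q, h6, fun e he => ?_⟩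
      by_cases hv : v ∈ e
      · exact Or.inr (hd e he hv)
      · exact Or.inl (hd' e he hv)
    have n7 : Q.card < 7 := by
      by_contra hge
      have : (11 - Q.card).choose 2 ≤ 6 := (Nat.choose_le_choose 2 (show _ ≤ 4 by omega)).trans (by decide)
      omega
    have h45 : Q.card = 4 ∨ Q.card = 5 := by omega
    right
    refine ⟨?_, v, Q, hvQ, h45, fun e he => ?_⟩
    · rcases h45 with h | h <;> rw [h] at hTle hL1 <;> simp [Nat.choose] at hTle hL1 <;> omega
    · by_cases hv : v ∈ e
      · exact Or.inr ⟨hv, hd e he hv⟩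
      · exact Or.inl (hd' e he hv)
  · left
    set N := Q.filter (fun x => ∃ e ∈ L, x ∈ e) with hN
    have mN : ∀ x, x ∈ N ↔ x ∈ Q ∧ ∃ e ∈ L, x ∈ e := fun x => by simp [hN]
    have hNQ : N ⊆ Q := Finset.filter_subset _ _
    have hLN : ∀ e ∈ L2, 2 ≤ (e ∩ N).card := by
      intro e he
      rw [hL2, Finset.mem_filter] at he
      obtain ⟨y, hy⟩ := Finset.nonempty_iff_ne_empty.2 he.2
      rw [Finset.mem_inter] at hy
      obtain ⟨h, hh, hyh⟩ := (mQ y).1 hy.2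
      have heL := (mL e).1 he.1
      have : e.erase v ⊆ e ∩ N := by
        intro z hz
        rw [Finset.mem_erase] at hz
        exact Finset.mem_inter.2 ⟨hz.2, (mN z).2 ⟨(mQ z).2 ⟨h, hh, hlink e he.1 h hh y hy.1 hyh z hz.2 hz.1⟩, e, he.1, hz.2⟩⟩
      have := Finset.card_le_card this
      rw [Finset.card_erase_of_mem heL.2, hU e heL.1] at this
      exact this
    have hn2 : 2 ≤ N.card := by
      obtain ⟨e, he⟩ := Finset.nonempty_iff_ne_empty.2 hn0
      exact (hLN e he).trans (Finset.card_le_card Finset.inter_subset_right)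
    -- partner
    have partner : ∀ x ∈ N, ∃ y, y ≠ x ∧ y ≠ v ∧ {v, x, y} ∈ L := by
      intro x hx
      obtain ⟨hxQ, e, he, hxe⟩ := (mN x).1 hx
      have heL := (mL e).1 he
      have hvx : v ≠ x := fun h => hvQ (h ▸ hxQ)
      obtain ⟨y, h1, h2, rfl⟩ := third hU hvx heL.1 heL.2 hxe
      exact ⟨y, h2, h1, he⟩
    have pin : ∀ x y, y ≠ v → {v, x, y} ∈ L → ∀ h ∈ T, x ∈ h → y ∈ h := by
      intro x y hyv he h hh hx
      exact hlink _ he h hh x (by simp) hx y (by simp) hyv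
    have pin' : ∀ x y, x ≠ v → {v, x, y} ∈ L → ∀ h ∈ T, y ∈ h → x ∈ h := by
      intro x y hyv he h hh hx
      exact hlink _ he h hh y (by simp) hx x (by simp) hyv
    have deg2 : ∀ x ∈ N, (L2.filter (fun e => x ∈ e)).card ≤ 2 ∧
        (2 ≤ (L2.filter (fun e => x ∈ e)).card → (T.filter (fun h => x ∈ h)).card ≤ 1) := by
      intro x hx
      obtain ⟨hxQ, -⟩ := (mN x).1 hx
      have hvx : v ≠ x := fun h => hvQ (h ▸ hxQ)
      obtain ⟨h, hh, hxh⟩ := (mQ x).1 hxQ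
      have hsub : L2.filter (fun e => x ∈ e) ⊆ (h.erase x).image (fun y => {v, x, y}) := by
        intro e he
        rw [Finset.mem_filter, hL2, Finset.mem_filter] at he
        have heL := (mL e).1 he.1.1
        obtain ⟨y, h1, h2, rfl⟩ := third hU hvx heL.1 heL.2 he.2
        exact Finset.mem_image.2 ⟨y, Finset.mem_erase.2 ⟨h2, pin x y h1 he.1.1 h hh hxh⟩, rfl⟩
      have hc : ((h.erase x).image (fun y => ({v, x, y} : Finset V12))).card ≤ 2 := by
        refine Finset.card_image_le.trans ?_
        rw [Finset.card_erase_of_mem hxh, hU h ((mT h).1 hh).1]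
      refine ⟨(Finset.card_le_card hsub).trans hc, fun h2 => ?_⟩
      have heq := Finset.eq_of_subset_of_card_le hsub (hc.trans h2)
      have key : ∀ h' ∈ T, x ∈ h' → h' = h := by
        intro h' hh' hxh'
        symm
        apply Finset.eq_of_subset_of_card_le
        · intro y hy
          by_cases hyx : y = x
          · exact hyx ▸ hxh'
          · have : ({v, x, y} : Finset V12) ∈ L2.filter (fun e => x ∈ e) := by
              rw [heq]; exact Finset.mem_image.2 ⟨y, Finset.mem_erase.2 ⟨hyx, hy⟩, rfl⟩
            rw [Finset.mem_filter, hL2, Finset.mem_filter] at this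
            exact pin x y (fun h'' => ((mT h).1 hh).2 (h'' ▸ hy)) this.1.1 h' hh' hxh'
        · rw [hU h ((mT h).1 hh).1, hU h' ((mT h').1 hh').1]
      rw [Finset.card_le_one]
      intro h1 hh1 h2 hh2
      rw [Finset.mem_filter] at hh1 hh2
      rw [key h1 hh1.1 hh1.2, key h2 hh2.1 hh2.2]
    have degm : ∀ x ∈ N, (T.filter (fun h => x ∈ h)).card ≤ max 1 (Q.card - N.card) := by
      intro x hx
      obtain ⟨hxQ, -⟩ := (mN x).1 hx
      have hvx : v ≠ x := fun h => hvQ (h ▸ hxQ)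
      obtain ⟨y, hyx, hyv, hxy⟩ := partner x hx
      by_cases hw : ∃ w ∈ N, ∃ h ∈ T, w ≠ x ∧ w ≠ y ∧ x ∈ h ∧ w ∈ h
      · obtain ⟨w, hwN, h, hh, hwx, hwy, hxh, hwh⟩ := hw
        refine le_trans ?_ (le_max_left _ _)
        obtain ⟨z, hzw, hzv, hwz⟩ := partner w hwN
        have hwv : w ≠ v := fun h' => hvQ (h' ▸ hNQ hwN)
        have hyh := pin x y hyv hxy h hh hxh
        have hzh := pin w z hzv hwz h hh hwh
        have hh3 : h = {x, y, w} := by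
          symm
          apply Finset.eq_of_subset_of_card_le
          · intro t ht
            simp only [Finset.mem_insert, Finset.mem_singleton] at ht
            rcases ht with rfl | rfl | rfl <;> assumption
          · rw [hU h ((mT h).1 hh).1, Finset.card_insert_of_notMem (by simp [hyx.symm, hwx.symm]),
              Finset.card_insert_of_notMem (by simp [hwy.symm]), Finset.card_singleton]
        have key : ∀ h' ∈ T, x ∈ h' → h' = h := by
          intro h' hh' hxh'
          have hy' := pin x y hyv hxy h' hh' hxh'
          have hw' : w ∈ h' := by
            rw [hh3] at hzh
            simp only [Finset.mem_insert, Finset.mem_singleton] at hzh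
            rcases hzh with rfl | rfl | rfl
            · exact pin' w z hwv hwz h' hh' hxh'
            · exact pin' w z hwv hwz h' hh' hy'
            · exact (hzw rfl).elim
          symm
          apply Finset.eq_of_subset_of_card_le
          · rw [hh3]
            intro t ht
            simp only [Finset.mem_insert, Finset.mem_singleton] at ht
            rcases ht with rfl | rfl | rfl <;> assumption
          · rw [hU h ((mT h).1 hh).1, hU h' ((mT h').1 hh').1]
        rw [Finset.card_le_one]
        intro h1 hh1 h2 hh2
        rw [Finset.mem_filter] at hh1 hh2
        rw [key h1 hh1.1 hh1.2, key h2 hh2.1 hh2.2]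
      · push Not at hw
        refine le_trans ?_ (le_max_right _ _)
        have hsub : T.filter (fun h => x ∈ h) ⊆ (Q \ N).image (fun w => {x, y, w}) := by
          intro h hh
          rw [Finset.mem_filter] at hh
          have hyh := pin x y hyv hxy h hh.1 hh.2
          obtain ⟨w, h1, h2, h3⟩ := third hU hyx.symm ((mT h).1 hh.1).1 hh.2 hyh
          have hwh : w ∈ h := by rw [h3]; simp
          refine Finset.mem_image.2 ⟨w, Finset.mem_sdiff.2 ⟨TQ h hh.1 hwh, fun hwN => ?_⟩, h3.symm⟩
          exact hw w hwN h hh.1 h1 h2 hh.2 hwh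
        have := (Finset.card_le_card hsub).trans Finset.card_image_le
        rwa [Finset.card_sdiff_of_subset hNQ] at this
    set m := max 1 (Q.card - N.card) with hm
    have hm1 : 1 ≤ m := le_max_left _ _
    set N3 := N.filter (fun x => 2 ≤ (L2.filter (fun e => x ∈ e)).card) with hN3
    set N2 := N.filter (fun x => ¬ 2 ≤ (L2.filter (fun e => x ∈ e)).card) with hN2
    have hNsplit : N2.card + N3.card = N.card := by
      rw [add_comm]; exact Finset.card_filter_add_card_filter_not _
    have s1 : 2 * L2.card ≤ N2.card + 2 * N3.card := by
      calc 2 * L2.card = ∑ e ∈ L2, 2 := by simp [mul_comm]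
        _ ≤ ∑ e ∈ L2, (e ∩ N).card := Finset.sum_le_sum hLN
        _ = ∑ x ∈ N, (L2.filter (fun e => x ∈ e)).card := (dc N L2).symm
        _ = ∑ x ∈ N3, (L2.filter (fun e => x ∈ e)).card + ∑ x ∈ N2, (L2.filter (fun e => x ∈ e)).card :=
            (Finset.sum_filter_add_sum_filter_not _ _ _).symm
        _ ≤ N3.card • 2 + N2.card • 1 := by
            apply Nat.add_le_add
            · exact Finset.sum_le_card_nsmul _ _ _ fun x hx => (deg2 x (Finset.mem_filter.1 hx).1).1
            · refine Finset.sum_le_card_nsmul _ _ _ fun x hx => ?_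
              have := (Finset.mem_filter.1 hx).2
              omega
        _ = _ := by simp only [smul_eq_mul]; ring
    set TN := T.filter (fun h => (h ∩ N).Nonempty) with hTN
    have sT : ∑ x ∈ N, (T.filter (fun h => x ∈ h)).card ≤ m * N2.card + N3.card := by
      rw [← Finset.sum_filter_add_sum_filter_not N (fun x => 2 ≤ (L2.filter (fun e => x ∈ e)).card), add_comm]
      apply Nat.add_le_add
      · rw [mul_comm, ← smul_eq_mul]
        exact Finset.sum_le_card_nsmul _ _ _ fun x hx => degm x (Finset.mem_filter.1 hx).1
      · have := Finset.sum_le_card_nsmul N3 (fun x => (T.filter (fun h => x ∈ h)).card) 1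
          (fun x hx => (deg2 x (Finset.mem_filter.1 hx).1).2 (Finset.mem_filter.1 hx).2)
        simpa using this
    have s2 : 2 * TN.card ≤ m * N2.card + N3.card := by
      refine le_trans ?_ sT
      calc 2 * TN.card = ∑ e ∈ TN, 2 := by simp [mul_comm]
        _ ≤ ∑ e ∈ TN, (e ∩ N).card := by
            apply Finset.sum_le_sum
            intro h hh
            rw [hTN, Finset.mem_filter] at hh
            obtain ⟨x, hx⟩ := hh.2
            rw [Finset.mem_inter] at hx
            obtain ⟨y, hyx, hyv, hxy⟩ := partner x hx.2
            have hyh := pin x y hyv hxy h hh.1 hx.1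
            have hyN : y ∈ N := (mN y).2 ⟨TQ h hh.1 hyh, _, hxy, by simp⟩
            apply Finset.one_lt_card.2
            exact ⟨x, Finset.mem_inter.2 hx, y, Finset.mem_inter.2 ⟨hyh, hyN⟩, hyx.symm⟩
        _ ≤ ∑ e ∈ T, (e ∩ N).card := Finset.sum_le_sum_of_subset (Finset.filter_subset _ _)
        _ = _ := (dc N T).symm
    have s3 : T.card ≤ TN.card + (Q.card - N.card).choose 3 := by
      have : T ⊆ TN ∪ (Q \ N).powersetCard 3 := by
        intro h hh
        rw [Finset.mem_union]
        by_cases hne : (h ∩ N).Nonempty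
        · exact Or.inl (Finset.mem_filter.2 ⟨hh, hne⟩)
        · right
          refine Finset.mem_powersetCard.2 ⟨fun x hx => Finset.mem_sdiff.2 ⟨TQ h hh hx, fun hxN => ?_⟩, hU h ((mT h).1 hh).1⟩
          exact hne ⟨x, Finset.mem_inter.2 ⟨hx, hxN⟩⟩
      have h := (Finset.card_le_card this).trans (Finset.card_union_le _ _)
      rwa [Finset.card_powersetCard, Finset.card_sdiff_of_subset hNQ] at h
    have s4 : 3 * T.card ≤ N.card * m + (Q.card - N.card) * T.card := by
      calc 3 * T.card = ∑ e ∈ T, 3 := by simp [mul_comm]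
        _ = ∑ e ∈ T, (e ∩ Q).card := by
            apply Finset.sum_congr rfl
            intro h hh
            rw [Finset.inter_eq_left.2 (TQ h hh), hU h ((mT h).1 hh).1]
        _ = ∑ x ∈ Q, (T.filter (fun h => x ∈ h)).card := (dc Q T).symm
        _ = ∑ x ∈ Q \ N, (T.filter (fun h => x ∈ h)).card + ∑ x ∈ N, (T.filter (fun h => x ∈ h)).card :=
            (Finset.sum_sdiff hNQ).symm
        _ ≤ (Q \ N).card • T.card + N.card • m := by
            apply Nat.add_le_add
            · exact Finset.sum_le_card_nsmul _ _ _ fun x _ => Finset.card_le_card (Finset.filter_subset _ _)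
            · exact Finset.sum_le_card_nsmul _ _ _ degm
        _ = _ := by rw [Finset.card_sdiff_of_subset hNQ]; simp only [smul_eq_mul]; ring
    rw [hE]
    exact numA Q.card N.card N2.card N3.card L2.card TN.card T.card L.card _ m hq3 hq11 hn2
      (Finset.card_le_card hNQ) rfl hm hNsplit s1 s2 s3 s4 hT2 hD (by omega)

/-- the triangle-free case -/
theorem cfree (hU : U3 E) (hP : PF E) (hC : CFr E)
    (hs : ¬ starS E) (hco : ¬ cometS E) (hk : ¬ K66s E) :
    E.card ≤ 24 ∨ (E.card ≤ 25 ∧ ExtS E) := by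
  by_cases h25 : E.card ≤ 24
  · exact Or.inl h25
  obtain ⟨v, -, hv⟩ := Finset.exists_max_image Finset.univ (fun v => (Lk E v).card) ⟨0, Finset.mem_univ _⟩
  have hmax : ∀ u, (Lk E u).card ≤ (Lk E v).card := fun u => hv u (Finset.mem_univ _)
  have hD : 7 ≤ (Lk E v).card := by
    have h1 := dc Finset.univ E
    have h2 : ∑ e ∈ E, (e ∩ Finset.univ).card = 3 * E.card := by
      rw [Finset.sum_congr rfl (fun e he => by rw [Finset.inter_univ, hU e he])]
      simp [mul_comm]
    have h3 := Finset.sum_le_card_nsmul Finset.univ (fun x => (E.filter (fun e => x ∈ e)).card) _ (fun x _ => hmax x)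
    simp only [Finset.card_univ, Fintype.card_fin, smul_eq_mul] at h3
    omega
  by_cases hA : ∀ e ∈ E, v ∈ e → ∀ h ∈ E, v ∉ h → (h ∩ e).card ≠ 1
  · exact caseA hU hD hA hs hco hk
  · push Not at hA
    obtain ⟨e, he, hve, h, hh, hvh, hc⟩ := hA
    rcases caseB hU hP hC hD hmax he hve hh hvh hc with h' | h'
    · exact Or.inl h'
    · exact (hk h').elim

end CA

section EX
open ThreeGraph

theorem K66_edges : ((KK 6).dUnion (KK 6)).edges =
    (Finset.range 6).powersetCard 3 ∪ (Finset.Ico 6 12).powersetCard 3 := by decide +kernel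
theorem K66_verts : ((KK 6).dUnion (KK 6)).verts = Finset.range 12 := by decide +kernel
theorem K5S7_edges : ((KK 5).dUnion (SS 7)).edges =
    (Finset.range 5).powersetCard 3 ∪ ((Finset.Ico 5 12).powersetCard 3).filter (fun e => 5 ∈ e) := by
  decide +kernel
theorem K5S7_verts : ((KK 5).dUnion (SS 7)).verts = Finset.range 12 := by decide +kernel
theorem K5S7_card : ((KK 5).dUnion (SS 7)).edges.card = 25 := by decide +kernel
theorem K4S8_edges : ((KK 4).dUnion (SS 8)).edges =
    (Finset.range 4).powersetCard 3 ∪ ((Finset.Ico 4 12).powersetCard 3).filter (fun e => 4 ∈ e) := by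
  decide +kernel
theorem K4S8_verts : ((KK 4).dUnion (SS 8)).verts = Finset.range 12 := by decide +kernel
theorem K4S8_card : ((KK 4).dUnion (SS 8)).edges.card = 25 := by decide +kernel
theorem K5S7_valid : ((KK 5).dUnion (SS 7)).IsValid := by
  unfold ThreeGraph.IsValid
  decide +kernel
theorem K4S8_valid : ((KK 4).dUnion (SS 8)).IsValid := by
  unfold ThreeGraph.IsValid
  decide +kernel

theorem iso_card {F H : ThreeGraph} (hF : F.IsValid) (h : IsoCopy F H) : H.edges.card = F.edges.card := by
  obtain ⟨f, hf, -, h3⟩ := h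
  rw [← h3]
  apply Finset.card_image_of_injOn
  intro e he e' he' heq
  have h1 := (hF e he).2
  have h2 := (hF e' he').2
  have heq' : e.image f = e'.image f := heq
  ext x
  constructor
  · intro hx
    have : f x ∈ e'.image f := heq' ▸ Finset.mem_image_of_mem f hx
    obtain ⟨y, hy, hyx⟩ := Finset.mem_image.1 this
    exact hf (h2 hy) (h1 hx) hyx ▸ hy
  · intro hx
    have : f x ∈ e.image f := heq' ▸ Finset.mem_image_of_mem f hx
    obtain ⟨y, hy, hyx⟩ := Finset.mem_image.1 this
    exact hf (h1 hy) (h2 hx) hyx ▸ hy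

theorem disj_image {f : ℕ → ℕ} {V e e' : Finset ℕ} (hf : Set.InjOn f ↑V) (he : e ⊆ V) (he' : e' ⊆ V)
    (hd : Disjoint e e') : Disjoint (e.image f) (e'.image f) := by
  rw [Finset.disjoint_left]
  intro x hx hx'
  obtain ⟨y, hy, rfl⟩ := Finset.mem_image.1 hx
  obtain ⟨z, hz, hzy⟩ := Finset.mem_image.1 hx'
  have := hf (he' hz) (he hy) hzy
  subst this
  exact Finset.disjoint_left.1 hd hy hz

theorem ne_image {f : ℕ → ℕ} {V e e' : Finset ℕ} {x : ℕ} (hf : Set.InjOn f ↑V) (he : e ⊆ V) (he' : e' ⊆ V)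
    (hx : x ∈ e) (hx' : x ∉ e') : e.image f ≠ e'.image f := by
  intro h
  have : f x ∈ e'.image f := h ▸ Finset.mem_image_of_mem f hx
  obtain ⟨y, hy, hyx⟩ := Finset.mem_image.1 this
  exact hx' (hf (he' hy) (he hx) hyx ▸ hy)

theorem SS_int : ∀ e ∈ (SS 12).edges, ∀ e' ∈ (SS 12).edges, ¬ Disjoint e e' := by decide +kernel
theorem G1_int : ∀ e ∈ (G1 12).edges, ∀ e' ∈ (G1 12).edges, ¬ Disjoint e e' := by decide +kernel
theorem G2_int : ∀ e ∈ (G2 12).edges, ∀ e' ∈ (G2 12).edges, ¬ Disjoint e e' := by decide +kernel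
theorem comet_int : ∀ e ∈ (comet 12).edges, ∀ e' ∈ (comet 12).edges, Disjoint e e' →
    e = {1,2,3} ∨ e' = {1,2,3} := by decide +kernel

theorem no_int {G : ThreeGraph} (h : ∀ e ∈ G.edges, ∀ e' ∈ G.edges, ¬ Disjoint e e') :
    ¬ G.ContainsCopy ((KK 5).dUnion (SS 7)) := by
  rintro ⟨f, hf, -, h3⟩
  have m1 : ({0,1,2} : Finset ℕ) ∈ ((KK 5).dUnion (SS 7)).edges := by decide +kernel
  have m2 : ({5,6,7} : Finset ℕ) ∈ ((KK 5).dUnion (SS 7)).edges := by decide +kernel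
  exact h _ (h3 _ m1) _ (h3 _ m2) (disj_image hf (K5S7_valid _ m1).2 (K5S7_valid _ m2).2 (by decide))

theorem no_comet : ¬ (comet 12).ContainsCopy ((KK 5).dUnion (SS 7)) := by
  rintro ⟨f, hf, -, h3⟩
  have m1 : ({0,1,2} : Finset ℕ) ∈ ((KK 5).dUnion (SS 7)).edges := by decide +kernel
  have m2 : ({5,6,7} : Finset ℕ) ∈ ((KK 5).dUnion (SS 7)).edges := by decide +kernel
  have m3 : ({1,2,3} : Finset ℕ) ∈ ((KK 5).dUnion (SS 7)).edges := by decide +kernel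
  have m4 : ({5,7,8} : Finset ℕ) ∈ ((KK 5).dUnion (SS 7)).edges := by decide +kernel
  have v1 := (K5S7_valid _ m1).2
  have v2 := (K5S7_valid _ m2).2
  have v3 := (K5S7_valid _ m3).2
  have v4 := (K5S7_valid _ m4).2
  have n1 := ne_image (x := 0) hf v1 v3 (by decide) (by decide)
  have n2 := ne_image (x := 6) hf v2 v4 (by decide) (by decide)
  have d12 := comet_int _ (h3 _ m1) _ (h3 _ m2) (disj_image hf v1 v2 (by decide))
  have d14 := comet_int _ (h3 _ m1) _ (h3 _ m4) (disj_image hf v1 v4 (by decide))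
  have d32 := comet_int _ (h3 _ m3) _ (h3 _ m2) (disj_image hf v3 v2 (by decide))
  have n3 := disj_image hf v1 v2 (by decide)
  rcases d12 with h | h
  · rcases d32 with h' | h'
    · exact n1 (h.trans h'.symm)
    · rw [h, h'] at n3
      exact absurd n3 (by decide)
  · rcases d14 with h' | h'
    · rw [h, h'] at n3
      exact absurd n3 (by decide)
    · exact n2 (h.trans h'.symm)

theorem no_K66 : ¬ ((KK 6).dUnion (KK 6)).ContainsCopy ((KK 5).dUnion (SS 7)) := by
  rintro ⟨f, hf, -, h3⟩
  rw [K66_edges] at h3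
  have key : ∀ A : Finset ℕ, A.card = 6 → (∀ x ∈ Finset.Ico 5 12, f x ∈ A) → False := by
    intro A hA h
    have h1 : ((Finset.Ico 5 12).image f).card = 7 := by
      rw [Finset.card_image_of_injOn]
      · rfl
      · apply hf.mono
        rw [K5S7_verts]
        intro x hx
        simp at hx ⊢
        omega
    have h2 : (Finset.Ico 5 12).image f ⊆ A := by
      intro y hy
      obtain ⟨x, hx, rfl⟩ := Finset.mem_image.1 hy
      exact h x hx
    have := Finset.card_le_card h2
    omega
  have mem : ∀ x ∈ Finset.Ico 5 12, ∃ s : Finset ℕ, s ∈ ((KK 5).dUnion (SS 7)).edges ∧ 5 ∈ s ∧ x ∈ s := by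
    intro x hx
    rw [Finset.mem_Ico] at hx
    obtain ⟨h1, h2⟩ := hx
    have a1 : ({5,6,7} : Finset ℕ) ∈ ((KK 5).dUnion (SS 7)).edges := by decide +kernel
    have a2 : ({5,8,9} : Finset ℕ) ∈ ((KK 5).dUnion (SS 7)).edges := by decide +kernel
    have a3 : ({5,10,11} : Finset ℕ) ∈ ((KK 5).dUnion (SS 7)).edges := by decide +kernel
    interval_cases x
    · exact ⟨_, a1, by decide, by decide⟩
    · exact ⟨_, a1, by decide, by decide⟩
    · exact ⟨_, a1, by decide, by decide⟩
    · exact ⟨_, a2, by decide, by decide⟩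
    · exact ⟨_, a2, by decide, by decide⟩
    · exact ⟨_, a3, by decide, by decide⟩
    · exact ⟨_, a3, by decide, by decide⟩
  by_cases h5 : f 5 < 6
  · apply key (Finset.range 6) (by simp)
    intro x hx
    obtain ⟨y, hy, h5s, hxs⟩ := mem x hx
    have := h3 _ hy
    rw [Finset.mem_union, Finset.mem_powersetCard, Finset.mem_powersetCard] at this
    rcases this with h | h
    · exact h.1 (Finset.mem_image_of_mem f hxs)
    · have := h.1 (Finset.mem_image_of_mem f h5s)
      rw [Finset.mem_Ico] at this
      omega
  · apply key (Finset.Ico 6 12) (by simp)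
    intro x hx
    obtain ⟨y, hy, h5s, hxs⟩ := mem x hx
    have := h3 _ hy
    rw [Finset.mem_union, Finset.mem_powersetCard, Finset.mem_powersetCard] at this
    rcases this with h | h
    · have := h.1 (Finset.mem_image_of_mem f h5s)
      rw [Finset.mem_range] at this
      omega
    · exact h.1 (Finset.mem_image_of_mem f hxs)

theorem K5S7_pf : ∀ e ∈ ((KK 5).dUnion (SS 7)).edges, ∀ f ∈ ((KK 5).dUnion (SS 7)).edges, (e ∩ f).card = 1 →
    ∀ g ∈ ((KK 5).dUnion (SS 7)).edges, (f ∩ g).card = 1 → ¬ Disjoint e g := by decide +kernel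

theorem inter_image {f : ℕ → ℕ} {V e e' : Finset ℕ} (hf : Set.InjOn f ↑V) (he : e ⊆ V) (he' : e' ⊆ V) :
    (e.image f ∩ e'.image f).card = (e ∩ e').card := by
  rw [← Finset.image_inter_of_injOn, Finset.card_image_of_injOn]
  · exact hf.mono (fun x hx => he (Finset.mem_inter.1 hx).1)
  · apply hf.mono
    intro x hx
    rcases hx with hx | hx
    · exact he hx
    · exact he' hx

theorem K5S7_free : ((KK 5).dUnion (SS 7)).Free pathP := by
  rintro ⟨f, hf, -, h3⟩
  have m1 := h3 {0,1,2} (by decide)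
  have m2 := h3 {2,3,4} (by decide)
  have m3 := h3 {4,5,6} (by decide)
  have s1 : ({0,1,2} : Finset ℕ) ⊆ pathP.verts := by decide
  have s2 : ({2,3,4} : Finset ℕ) ⊆ pathP.verts := by decide
  have s3 : ({4,5,6} : Finset ℕ) ⊆ pathP.verts := by decide
  exact K5S7_pf _ m1 _ m2 (by rw [inter_image hf s1 s2]; decide) _ m3
    (by rw [inter_image hf s2 s3]; decide) (disj_image hf s1 s3 (by decide))

theorem K5S7_mem : ∃ H : ThreeGraph, H.IsValid ∧ H.verts.card = 12 ∧
      H.Free pathP ∧ (∀ G ∈ L12, ¬ G.ContainsCopy H) ∧ H.edges.card = 25 := by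
  refine ⟨(KK 5).dUnion (SS 7), K5S7_valid, by rw [K5S7_verts]; simp, K5S7_free, ?_, K5S7_card⟩
  intro G hG
  simp only [L12, List.mem_cons, List.not_mem_nil, or_false] at hG
  rcases hG with rfl | rfl | rfl | rfl | rfl
  · exact no_int SS_int
  · exact no_K66
  · exact no_comet
  · exact no_int G1_int
  · exact no_int G2_int

end EX

section TR
open ThreeGraph

theorem placeFn {k : ℕ} (hk : k ≤ 12) (g : Fin k → V12) (hg : Function.Injective g) :
    ∃ σ : Equiv.Perm V12, ∀ i, σ (g i) = Fin.castLE hk i := by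
  classical
  have hc : Function.Injective (Fin.castLE hk) := Fin.castLE_injective hk
  let e : {x // x ∈ Set.range g} ≃ {x // x ∈ Set.range (Fin.castLE hk)} :=
    (Equiv.ofInjective g hg).symm.trans (Equiv.ofInjective _ hc)
  refine ⟨e.extendSubtype, fun i => ?_⟩
  rw [Equiv.extendSubtype_apply_of_mem e (g i) ⟨i, rfl⟩]
  have : (Equiv.ofInjective g hg).symm ⟨g i, ⟨i, rfl⟩⟩ = i := by
    rw [Equiv.symm_apply_eq]; rfl
  simp only [e, Equiv.trans_apply]
  rw [this]
  rfl

theorem placeSet (A : Finset V12) (v : V12) (hv : v ∉ A) :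
    ∃ σ : Equiv.Perm V12, (∀ x, (σ x).val < A.card ↔ x ∈ A) ∧ (σ v).val = A.card := by
  have hk : A.card + 1 ≤ 12 := by
    have := Finset.card_le_univ (insert v A)
    rw [Finset.card_insert_of_notMem hv] at this
    simpa using this
  let a := A.equivFin.symm
  let g : Fin (A.card + 1) → V12 := Fin.snoc (α := fun _ => V12) (fun i => (a i).1) v
  have hg : Function.Injective g := by
    rw [Fin.snoc_injective_iff]
    refine ⟨Subtype.val_injective.comp a.injective, ?_⟩
    rintro ⟨i, rfl⟩
    exact hv (a i).2
  obtain ⟨σ, hσ⟩ := placeFn hk g hg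
  have h1 : ∀ i : Fin A.card, (σ (a i).1).val = i := by
    intro i
    have := hσ i.castSucc
    simp only [g, Fin.snoc_castSucc] at this
    rw [this]; rfl
  refine ⟨σ, fun x => ⟨fun h => ?_, fun h => ?_⟩, ?_⟩
  · have h2 := h1 ⟨(σ x).val, h⟩
    have h3 : σ (a ⟨(σ x).val, h⟩).1 = σ x := Fin.ext h2
    rw [← σ.injective h3]
    exact (a _).2
  · have h2 := h1 (a.symm ⟨x, h⟩)
    rw [Equiv.apply_symm_apply] at h2
    rw [h2]
    exact Fin.is_lt _
  · have := hσ (Fin.last _)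
    simp only [g, Fin.snoc_last] at this
    rw [this]; rfl

def Lab (H : ThreeGraph) (φ : V12 → ℕ) : Prop := Function.Injective φ ∧ Finset.univ.image φ = H.verts

def GE (H : ThreeGraph) (φ : V12 → ℕ) : Finset (Finset V12) :=
  Finset.univ.filter (fun t => t.image φ ∈ H.edges)

variable {H : ThreeGraph} {φ : V12 → ℕ}

theorem mem_GE {t : Finset V12} : t ∈ GE H φ ↔ t.image φ ∈ H.edges := by simp [GE]

theorem Lab.comp (h : Lab H φ) (σ : Equiv.Perm V12) : Lab H (φ ∘ σ) := by
  refine ⟨h.1.comp σ.injective, ?_⟩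
  rw [← Finset.image_image, Finset.image_univ_equiv, h.2]

theorem mem_GE_comp {σ : V12 → V12} {t : Finset V12} : t ∈ GE H (φ ∘ σ) ↔ t.image σ ∈ GE H φ := by
  rw [mem_GE, mem_GE, Finset.image_image]

theorem exists_Lab (h : H.verts.card = 12) : ∃ φ, Lab H φ := by
  refine ⟨H.verts.orderEmbOfFin h, (H.verts.orderEmbOfFin h).injective, ?_⟩
  exact Finset.image_orderEmbOfFin_univ _ h

theorem GE_image (hH : H.IsValid) (h : Lab H φ) : (GE H φ).image (Finset.image φ) = H.edges := by
  ext s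
  rw [Finset.mem_image]
  constructor
  · rintro ⟨t, ht, rfl⟩
    exact mem_GE.1 ht
  · intro hs
    have h1 := (hH s hs).2
    rw [← h.2] at h1
    obtain ⟨t, -, ht⟩ := Finset.subset_image_iff.1 h1
    exact ⟨t, mem_GE.2 (ht ▸ hs), ht⟩

theorem GE_card (hH : H.IsValid) (h : Lab H φ) : (GE H φ).card = H.edges.card := by
  rw [← GE_image hH h, Finset.card_image_of_injective _ (Finset.image_injective h.1)]

theorem GE_U3 (hH : H.IsValid) (h : Lab H φ) : U3 (GE H φ) := by
  intro t ht
  rw [← (hH _ (mem_GE.1 ht)).1, Finset.card_image_of_injective _ h.1]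

theorem split1 {t : Finset V12} (h : t.card = 3) {c : V12} (hc : c ∈ t) :
    ∃ a b, t = {c, a, b} ∧ c ≠ a ∧ c ≠ b ∧ a ≠ b := by
  have h2 : (t.erase c).card = 2 := by rw [Finset.card_erase_of_mem hc, h]
  obtain ⟨a, b, hab, he⟩ := Finset.card_eq_two.1 h2
  have ha : a ∈ t.erase c := by rw [he]; simp
  have hb : b ∈ t.erase c := by rw [he]; simp
  refine ⟨a, b, ?_, (Finset.ne_of_mem_erase ha).symm, (Finset.ne_of_mem_erase hb).symm, hab⟩
  rw [← he, Finset.insert_erase hc]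

theorem split2 {t : Finset V12} (h : t.card = 3) {c d : V12} (hc : c ∈ t) (hd : d ∈ t) (hcd : c ≠ d) :
    ∃ a, t = {c, d, a} ∧ c ≠ a ∧ d ≠ a := by
  obtain ⟨a, b, rfl, h1, h2, h3⟩ := split1 h hc
  simp only [Finset.mem_insert, Finset.mem_singleton] at hd
  rcases hd with rfl | rfl | rfl
  · exact absurd rfl hcd
  · exact ⟨b, rfl, h2, h3⟩
  · exact ⟨a, by rw [Finset.pair_comm], h1, h3.symm⟩

theorem path_copy (hφ : Function.Injective φ) (hv : ∀ x, φ x ∈ H.verts) {e f g : Finset V12}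
    (he : e ∈ GE H φ) (hf : f ∈ GE H φ) (hg : g ∈ GE H φ) (h3 : U3 (GE H φ))
    (h1 : (e ∩ f).card = 1) (h2 : (f ∩ g).card = 1) (h0 : (e ∩ g).card = 0) :
    H.ContainsCopy pathP := by
  obtain ⟨c, hc⟩ := Finset.card_eq_one.1 h1
  obtain ⟨d, hd⟩ := Finset.card_eq_one.1 h2
  rw [Finset.card_eq_zero] at h0
  have c1 : c ∈ e ∩ f := by rw [hc]; simp
  have d1 : d ∈ f ∩ g := by rw [hd]; simp
  rw [Finset.mem_inter] at c1 d1
  have mc : ∀ y, y ∈ e → y ∈ f → y = c := fun y h h' => by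
    have : y ∈ e ∩ f := Finset.mem_inter.2 ⟨h, h'⟩
    rw [hc] at this; simpa using this
  have md : ∀ y, y ∈ f → y ∈ g → y = d := fun y h h' => by
    have : y ∈ f ∩ g := Finset.mem_inter.2 ⟨h, h'⟩
    rw [hd] at this; simpa using this
  have m0 : ∀ y, y ∈ e → y ∉ g := fun y h h' => by
    have : y ∈ e ∩ g := Finset.mem_inter.2 ⟨h, h'⟩
    rw [h0] at this; simp at this
  have hcd : c ≠ d := fun h => m0 c c1.1 (h ▸ d1.2)
  obtain ⟨a, b, rfl, e1, e2, e3⟩ := split1 (h3 e he) c1.1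
  obtain ⟨x, rfl, f1, f2⟩ := split2 (h3 f hf) c1.2 d1.1 hcd
  obtain ⟨p, q, rfl, g1, g2, g3⟩ := split1 (h3 g hg) d1.2
  have nd : [a,b,c,x,d,p,q].Nodup := by
    have ma := mc a (by simp)
    have mb := mc b (by simp)
    have mp := md p
    have mq := md q
    have na := m0 a (by simp)
    have nb := m0 b (by simp)
    have nc := m0 c (by simp)
    simp at ma mb mp mq na nb nc
    simp
    grind
  refine ⟨fun n => φ ([a,b,c,x,d,p,q].getD n 0), ?_, fun v _ => hv _, ?_⟩
  · intro i hi j hj hij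
    have hi' : i < 7 := by
      have : ∀ i ∈ pathP.verts, i < 7 := by decide
      exact this i hi
    have hj' : j < 7 := by
      have : ∀ i ∈ pathP.verts, i < 7 := by decide
      exact this j hj
    have := hφ hij
    rw [List.getD_eq_getElem _ _ hi', List.getD_eq_getElem _ _ hj'] at this
    exact (List.Nodup.getElem_inj_iff nd).1 this
  · rw [mem_GE] at he hf hg
    simp only [Finset.image_insert, Finset.image_singleton] at he hf hg
    intro s hs
    simp only [pathP, Finset.mem_insert, Finset.mem_singleton] at hs
    rcases hs with rfl | rfl | rfl
    · convert he using 1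
      simp
      ext y; simp; tauto
    · convert hf using 1
      simp
      ext y; simp; tauto
    · convert hg using 1
      simp

theorem GE_PF (hH : H.IsValid) (h : Lab H φ) (hF : H.Free pathP) : PF (GE H φ) := by
  have hv : ∀ x, φ x ∈ H.verts := fun x => by rw [← h.2]; simp
  have hU := GE_U3 hH h
  intro e he f hf g hg
  by_contra hc
  rw [Bool.not_eq_false] at hc
  simp only [P3, Bool.or_eq_true, decide_eq_true_eq] at hc
  rcases hc with (⟨h1, h2, h3⟩ | ⟨h1, h2, h3⟩) | ⟨h1, h2, h3⟩
  · exact hF (path_copy h.1 hv he hf hg hU h1 h2 h3)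
  · exact hF (path_copy h.1 hv hf he hg hU (by rwa [Finset.inter_comm]) h3 h2)
  · exact hF (path_copy h.1 hv he hg hf hU h3 (by rwa [Finset.inter_comm]) h1)

theorem copy_of (hH : H.IsValid) (h : Lab H φ) {G : ThreeGraph} (σ : Equiv.Perm V12)
    (hG : G.verts = Finset.range 12)
    (hm : ∀ t ∈ GE H φ, t.image (fun x => (σ x).val) ∈ G.edges) : G.ContainsCopy H := by
  have hinv : ∀ x, Function.invFun φ (φ x) = x := Function.leftInverse_invFun h.1
  refine ⟨fun n => (σ (Function.invFun φ n)).val, ?_, ?_, ?_⟩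
  · intro i hi j hj hij
    rw [← h.2] at hi hj
    simp only [Finset.coe_image, Finset.coe_univ, Set.image_univ, Set.mem_range] at hi hj
    obtain ⟨x, rfl⟩ := hi
    obtain ⟨y, rfl⟩ := hj
    simp only [hinv] at hij
    rw [σ.injective (Fin.ext hij)]
  · intro v _
    rw [hG, Finset.mem_range]
    exact Fin.is_lt _
  · intro s hs
    rw [← GE_image hH h] at hs
    obtain ⟨t, ht, rfl⟩ := Finset.mem_image.1 hs
    have := hm t ht
    rw [Finset.image_image]
    convert this using 2
    ext x
    simp [hinv]

theorem img3 (σ : Equiv.Perm V12) {t : Finset V12} (h : t.card = 3) :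
    t.image (fun x => (σ x).val) ∈ (Finset.range 12).powersetCard 3 := by
  rw [Finset.mem_powersetCard]
  constructor
  · intro y hy
    obtain ⟨x, -, rfl⟩ := Finset.mem_image.1 hy
    simp
  · rw [Finset.card_image_of_injective, h]
    exact Fin.val_injective.comp σ.injective

theorem no_star (hH : H.IsValid) (h : Lab H φ) (hL : ∀ G ∈ L12, ¬ G.ContainsCopy H) : ¬ starS (GE H φ) := by
  rintro ⟨v, hv⟩
  obtain ⟨σ, h1, h2⟩ := placeSet ∅ v (by simp)
  refine hL (SS 12) (by simp [L12]) (copy_of hH h σ rfl ?_)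
  intro t ht
  refine Finset.mem_filter.2 ⟨img3 σ (GE_U3 hH h t ht), ?_⟩
  exact Finset.mem_image.2 ⟨v, hv t ht, h2⟩

theorem no_K66s (hH : H.IsValid) (h : Lab H φ) (hL : ∀ G ∈ L12, ¬ G.ContainsCopy H) : ¬ K66s (GE H φ) := by
  rintro ⟨U, hU, hv⟩
  obtain ⟨v, hvU⟩ : ∃ v, v ∉ U := by
    by_contra hc
    push Not at hc
    have : U = Finset.univ := Finset.eq_univ_iff_forall.2 hc
    rw [this] at hU
    simp at hU
  obtain ⟨σ, h1, h2⟩ := placeSet U v hvU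
  rw [hU] at h1 h2
  refine hL ((KK 6).dUnion (KK 6)) (by simp [L12]) (copy_of hH h σ K66_verts ?_)
  intro t ht
  have h3 := Finset.mem_powersetCard.1 (img3 σ (GE_U3 hH h t ht))
  rw [K66_edges, Finset.mem_union, Finset.mem_powersetCard, Finset.mem_powersetCard]
  rcases hv t ht with h' | h'
  · left
    refine ⟨fun y hy => ?_, h3.2⟩
    obtain ⟨x, hx, rfl⟩ := Finset.mem_image.1 hy
    exact Finset.mem_range.2 ((h1 x).2 (h' hx))
  · right
    refine ⟨fun y hy => ?_, h3.2⟩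
    obtain ⟨x, hx, rfl⟩ := Finset.mem_image.1 hy
    rw [Finset.mem_Ico]
    refine ⟨?_, Fin.is_lt _⟩
    by_contra hc
    have : x ∈ t ∩ U := Finset.mem_inter.2 ⟨hx, (h1 x).1 (by omega)⟩
    rw [h'] at this
    simp at this

theorem img_eq {σ : Equiv.Perm V12} {T : Finset V12} (hT : T.card = 3)
    (h : ∀ x, (σ x).val < 3 ↔ x ∈ T) : T.image (fun x => (σ x).val) = {0,1,2} := by
  apply Finset.eq_of_subset_of_card_le
  · intro y hy
    obtain ⟨x, hx, rfl⟩ := Finset.mem_image.1 hy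
    have := (h x).2 hx
    simp only [Finset.mem_insert, Finset.mem_singleton]
    omega
  · rw [(Finset.mem_powersetCard.1 (img3 σ hT)).2]; rfl

theorem img_inter {σ : Equiv.Perm V12} {t T : Finset V12} (hT : T.card = 3)
    (h : ∀ x, (σ x).val < 3 ↔ x ∈ T) :
    t.image (fun x => (σ x).val) ∩ {0,1,2} = (t ∩ T).image (fun x => (σ x).val) := by
  rw [← img_eq hT h, Finset.image_inter]
  exact Fin.val_injective.comp σ.injective

theorem no_G1s (hH : H.IsValid) (h : Lab H φ) (hL : ∀ G ∈ L12, ¬ G.ContainsCopy H) : ¬ G1s (GE H φ) := by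
  rintro ⟨T, v, hT, hvT, hv⟩
  obtain ⟨σ, h1, h2⟩ := placeSet T v hvT
  rw [hT] at h1 h2
  refine hL (G1 12) (by simp [L12]) (copy_of hH h σ rfl ?_)
  intro t ht
  refine Finset.mem_insert.2 ?_
  rcases hv t ht with rfl | ⟨h', h''⟩
  · exact Or.inl (img_eq hT h1)
  · right
    refine Finset.mem_filter.2 ⟨img3 σ (GE_U3 hH h t ht), Finset.mem_image.2 ⟨v, h', h2⟩, ?_⟩
    rw [img_inter hT h1]
    exact h''.image _

theorem no_G2s (hH : H.IsValid) (h : Lab H φ) (hL : ∀ G ∈ L12, ¬ G.ContainsCopy H) : ¬ G2s (GE H φ) := by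
  rintro ⟨T, hT, hv⟩
  obtain ⟨v, hvU⟩ : ∃ v, v ∉ T := by
    by_contra hc
    push Not at hc
    have : T = Finset.univ := Finset.eq_univ_iff_forall.2 hc
    rw [this] at hT
    simp at hT
  obtain ⟨σ, h1, h2⟩ := placeSet T v hvU
  rw [hT] at h1 h2
  refine hL (G2 12) (by simp [L12]) (copy_of hH h σ rfl ?_)
  intro t ht
  refine Finset.mem_insert.2 ?_
  rcases hv t ht with rfl | h'
  · exact Or.inl (img_eq hT h1)
  · right
    refine Finset.mem_filter.2 ⟨img3 σ (GE_U3 hH h t ht), ?_⟩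
    rw [img_inter hT h1, Finset.card_image_of_injective, h']
    exact Fin.val_injective.comp σ.injective

theorem no_cometS (hH : H.IsValid) (h : Lab H φ) (hL : ∀ G ∈ L12, ¬ G.ContainsCopy H) : ¬ cometS (GE H φ) := by
  rintro ⟨v, B, hB, hvB, hv⟩
  obtain ⟨σ₀, h1', h2'⟩ := placeSet B v hvB
  rw [hB] at h1' h2'
  obtain ⟨σ, h1, h2⟩ : ∃ σ : Equiv.Perm V12, (∀ x, (1 ≤ (σ x).val ∧ (σ x).val ≤ 3) ↔ x ∈ B) ∧ (σ v).val = 0 := by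
    refine ⟨σ₀.trans (Equiv.swap 0 3), fun x => ?_, ?_⟩
    · rw [← h1' x, Equiv.trans_apply]
      generalize σ₀ x = y
      revert y
      decide
    · rw [Equiv.trans_apply]
      have : σ₀ v = 3 := Fin.ext h2'
      rw [this]
      decide
  refine hL (comet 12) (by simp [L12]) (copy_of hH h σ rfl ?_)
  intro t ht
  have h3 := Finset.mem_powersetCard.1 (img3 σ (GE_U3 hH h t ht))
  refine Finset.mem_union.2 ?_
  rcases hv t ht with h' | ⟨h', h''⟩
  · left
    refine Finset.mem_powersetCard.2 ⟨fun y hy => ?_, h3.2⟩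
    obtain ⟨x, hx, rfl⟩ := Finset.mem_image.1 hy
    rcases Finset.mem_insert.1 (h' hx) with rfl | hxB
    · rw [h2]; decide
    · have := (h1 x).2 hxB
      simp only [Finset.mem_insert, Finset.mem_singleton]
      omega
  · right
    refine Finset.mem_filter.2 ⟨Finset.mem_powersetCard.2 ⟨fun y hy => ?_, h3.2⟩, Finset.mem_image.2 ⟨v, h', h2⟩⟩
    obtain ⟨x, hx, rfl⟩ := Finset.mem_image.1 hy
    have : x ∉ B := by
      intro hxB
      have : x ∈ t ∩ B := Finset.mem_inter.2 ⟨hx, hxB⟩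
      rw [h''] at this
      simp at this
    rw [← h1 x] at this
    have := (σ x).is_lt
    simp only [Finset.mem_insert, Finset.mem_Ico]
    omega

/-- rotation of the triangle -/
def rot : Equiv.Perm V12 where
  toFun := ![2,3,4,5,0,1,6,7,8,9,10,11]
  invFun := ![4,5,0,1,2,3,6,7,8,9,10,11]
  left_inv := by decide
  right_inv := by decide

theorem rot_CE (h : ∀ c ∈ CE, c ∈ GE H φ) : ∀ c ∈ CE, c ∈ GE H (φ ∘ rot) := by
  have h1 : ∀ c ∈ CE, c.image rot ∈ CE := by decide +kernel
  intro c hc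
  rw [mem_GE_comp]
  exact h _ (h1 c hc)

theorem tri_case (hH : H.IsValid) (h : Lab H φ) (hF : H.Free pathP) (hL : ∀ G ∈ L12, ¬ G.ContainsCopy H)
    (hC : ∀ c ∈ CE, c ∈ GE H φ) : H.edges.card ≤ 24 := by
  have step : ∀ ψ, Lab H ψ → (∀ c ∈ CE, c ∈ GE H ψ) → ∀ w ∈ WW, insert w {0,3} ∈ GE H ψ → H.edges.card ≤ 24 := by
    intro ψ hψ hCψ w hw hi
    rcases ccaseI (GE_U3 hH hψ) (GE_PF hH hψ hF) hCψ hw hi with h' | h'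
    · rwa [GE_card hH hψ] at h'
    · exact absurd h' (no_G1s hH hψ hL)
  by_contra hc
  have hC1 := rot_CE hC
  have hC2 := rot_CE hC1
  have hno : ∀ w ∈ WW, ∀ p ∈ P6, insert w p ∈ GE H φ → p ∈ [{0,2},{2,4},{0,4}] := by
    intro w hw p hp hi
    have r1 : ∀ w ∈ WW, (insert w ({0,3} : Finset V12)).image rot = insert w {2,5} := by decide +kernel
    have r2 : ∀ w ∈ WW, (insert w ({2,5} : Finset V12)).image rot = insert w {1,4} := by decide +kernel
    simp only [P6, List.mem_cons, List.not_mem_nil, or_false] at hp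
    rcases hp with rfl | rfl | rfl | rfl | rfl | rfl
    · simp
    · simp
    · simp
    · exact absurd (step φ h hC w hw hi) hc
    · refine absurd (step _ (h.comp rot) hC1 w hw ?_) hc
      rw [mem_GE_comp, r1 w hw]; exact hi
    · refine absurd (step _ ((h.comp rot).comp rot) hC2 w hw ?_) hc
      rw [mem_GE_comp, r1 w hw, mem_GE_comp, r2 w hw]; exact hi
  rcases ccaseIII (GE_U3 hH h) (GE_PF hH h hF) hC hno with h' | h' | h'
  · rw [GE_card hH h] at h'; exact hc h'
  · exact no_K66s hH h hL h'
  · exact no_G2s hH h hL h'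

theorem tri_label (hH : H.IsValid) (h : Lab H φ) (hC : ¬ CFr (GE H φ)) :
    ∃ ψ, Lab H ψ ∧ ∀ c ∈ CE, c ∈ GE H ψ := by
  have h3 := GE_U3 hH h
  unfold CFr at hC
  push Not at hC
  obtain ⟨e, he, f, hf, g, hg, h1, h2, h0, hn⟩ := hC
  obtain ⟨p, hp⟩ := Finset.card_eq_one.1 h1
  obtain ⟨q, hq⟩ := Finset.card_eq_one.1 h2
  obtain ⟨r, hr⟩ := Finset.card_eq_one.1 h0
  have p1 : p ∈ e ∩ f := by rw [hp]; simp
  have q1 : q ∈ f ∩ g := by rw [hq]; simp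
  have r1 : r ∈ e ∩ g := by rw [hr]; simp
  rw [Finset.mem_inter] at p1 q1 r1
  have mp : ∀ y, y ∈ e → y ∈ f → y = p := fun y h h' => by
    have : y ∈ e ∩ f := Finset.mem_inter.2 ⟨h, h'⟩
    rw [hp] at this; simpa using this
  have mq : ∀ y, y ∈ f → y ∈ g → y = q := fun y h h' => by
    have : y ∈ f ∩ g := Finset.mem_inter.2 ⟨h, h'⟩
    rw [hq] at this; simpa using this
  have mr : ∀ y, y ∈ e → y ∈ g → y = r := fun y h h' => by
    have : y ∈ e ∩ g := Finset.mem_inter.2 ⟨h, h'⟩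
    rw [hr] at this; simpa using this
  have mn : ∀ y, y ∈ e → y ∈ f → y ∉ g := fun y h h' h'' => by
    have : y ∈ e ∩ f ∩ g := Finset.mem_inter.2 ⟨Finset.mem_inter.2 ⟨h, h'⟩, h''⟩
    simp [hn] at this
  have npr : p ≠ r := fun h => mn p p1.1 p1.2 (h ▸ r1.2)
  have npq : p ≠ q := fun h => mn p p1.1 p1.2 (h ▸ q1.2)
  have nqr : q ≠ r := fun h => mn q (h ▸ r1.1) q1.1 q1.2
  obtain ⟨x, rfl, e1, e2⟩ := split2 (h3 e he) r1.1 p1.1 npr.symm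
  obtain ⟨y, rfl, f1, f2⟩ := split2 (h3 f hf) p1.2 q1.1 npq
  obtain ⟨z, rfl, g1, g2⟩ := split2 (h3 g hg) q1.2 r1.2 nqr
  have a1 := mp x (by simp)
  have a2 := mr x (by simp)
  have a3 := mq y (by simp)
  have a4 := mp q
  have a5 := mq p (by simp)
  have a6 := mr p (by simp)
  have a7 := mq r
  have a8 := mp r (by simp)
  have a9 := mr q
  have b1 := mp y
  have b2 := mr z
  have b3 := mq z
  simp at a1 a2 a3 a4 a5 a6 a7 a8 a9 b1 b2 b3
  have nd : [r,x,p,y,q,z].Nodup := by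
    simp
    grind
  have hinj : Function.Injective (fun i : Fin 6 => [r,x,p,y,q,z].get i) := List.nodup_iff_injective_get.1 nd
  obtain ⟨σ, hσ⟩ := placeFn (by norm_num) _ hinj
  refine ⟨φ ∘ σ.symm, h.comp σ.symm, ?_⟩
  have s0 : σ.symm 0 = r := by rw [Equiv.symm_apply_eq]; exact (hσ 0).symm
  have s1 : σ.symm 1 = x := by rw [Equiv.symm_apply_eq]; exact (hσ 1).symm
  have s2 : σ.symm 2 = p := by rw [Equiv.symm_apply_eq]; exact (hσ 2).symm
  have s3 : σ.symm 3 = y := by rw [Equiv.symm_apply_eq]; exact (hσ 3).symm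
  have s4 : σ.symm 4 = q := by rw [Equiv.symm_apply_eq]; exact (hσ 4).symm
  have s5 : σ.symm 5 = z := by rw [Equiv.symm_apply_eq]; exact (hσ 5).symm
  intro c hc
  rw [mem_GE_comp]
  simp only [CE, List.mem_cons, List.not_mem_nil, or_false] at hc
  rcases hc with rfl | rfl | rfl
  · simp only [Finset.image_insert, Finset.image_singleton, s0, s1, s2]
    convert he using 1
    rw [Finset.pair_comm]
  · simp only [Finset.image_insert, Finset.image_singleton, s2, s3, s4]
    convert hf using 1
    rw [Finset.pair_comm]
  · simp only [Finset.image_insert, Finset.image_singleton, s0, s4, s5]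
    convert hg using 1
    rw [Finset.insert_comm]

theorem upper (hH : H.IsValid) (h : Lab H φ) (hF : H.Free pathP) (hL : ∀ G ∈ L12, ¬ G.ContainsCopy H) :
    H.edges.card ≤ 24 ∨ (H.edges.card ≤ 25 ∧ ExtS (GE H φ)) := by
  by_cases hC : CFr (GE H φ)
  · have := cfree (GE_U3 hH h) (GE_PF hH h hF) hC (no_star hH h hL) (no_cometS hH h hL) (no_K66s hH h hL)
    rwa [GE_card hH h] at this
  · obtain ⟨ψ, hψ, hCE⟩ := tri_label hH h hC
    exact Or.inl (tri_case hH hψ hF hL hCE)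

theorem iso_of (hH : H.IsValid) (h : Lab H φ) {F : ThreeGraph} (σ : Equiv.Perm V12)
    (hV : F.verts = Finset.range 12) (hFe : F.edges.card = 25) (hc : H.edges.card = 25)
    (hm : ∀ t ∈ GE H φ, t.image (fun x => (σ x).val) ∈ F.edges) : IsoCopy F H := by
  have heq : (GE H φ).image (Finset.image (fun x => (σ x).val)) = F.edges := by
    apply Finset.eq_of_subset_of_card_le
    · intro s hs
      obtain ⟨t, ht, rfl⟩ := Finset.mem_image.1 hs
      exact hm t ht
    · rw [Finset.card_image_of_injective, GE_card hH h, hc, hFe]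
      exact Finset.image_injective (Fin.val_injective.comp σ.injective)
  have hr : Finset.range 12 = Finset.univ.image (fun x : V12 => (σ x).val) := by
    have : (fun x : V12 => (σ x).val) = Fin.val ∘ σ := rfl
    rw [this, ← Finset.image_image, Finset.image_univ_equiv]
    decide
  have key : ∀ x, φ (σ.symm (Fin.ofNat 12 (σ x).val)) = φ x := by
    intro x
    have : Fin.ofNat 12 (σ x).val = σ x := by
      apply Fin.ext
      simp
    rw [this, Equiv.symm_apply_apply]
  have key2 : (fun n => φ (σ.symm (Fin.ofNat 12 n))) ∘ (fun x : V12 => (σ x).val) = φ := funext key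
  refine ⟨fun n => φ (σ.symm (Fin.ofNat 12 n)), ?_, ?_, ?_⟩
  · intro i hi j hj hij
    rw [hV, hr] at hi hj
    obtain ⟨x, -, rfl⟩ := Finset.mem_image.1 hi
    obtain ⟨y, -, rfl⟩ := Finset.mem_image.1 hj
    have hij' := (key x).symm.trans (hij.trans (key y))
    rw [h.1 hij']
  · rw [hV, hr, Finset.image_image, key2, h.2]
  · rw [← heq, ← GE_image hH h, Finset.image_image]
    apply Finset.image_congr
    intro t _
    simp only [Function.comp_apply]
    rw [Finset.image_image, key2]

theorem ext_iso (hH : H.IsValid) (h : Lab H φ) (hc : H.edges.card = 25) (hE : ExtS (GE H φ)) :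
    IsoCopy ((KK 5).dUnion (SS 7)) H ∨ IsoCopy ((KK 4).dUnion (SS 8)) H := by
  obtain ⟨v, I, hv, hI, hsub⟩ := hE
  obtain ⟨σ, h1, h2⟩ := placeSet I v hv
  have key : ∀ t ∈ GE H φ, t.image (fun x => (σ x).val) ∈
      (Finset.range I.card).powersetCard 3 ∪ ((Finset.Ico I.card 12).powersetCard 3).filter (fun e => I.card ∈ e) := by
    intro t ht
    have h3 := Finset.mem_powersetCard.1 (img3 σ (GE_U3 hH h t ht))
    rw [Finset.mem_union, Finset.mem_filter, Finset.mem_powersetCard, Finset.mem_powersetCard]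
    rcases hsub t ht with h' | ⟨h', h''⟩
    · left
      refine ⟨fun y hy => ?_, h3.2⟩
      obtain ⟨x, hx, rfl⟩ := Finset.mem_image.1 hy
      exact Finset.mem_range.2 ((h1 x).2 (h' hx))
    · right
      refine ⟨⟨fun y hy => ?_, h3.2⟩, Finset.mem_image.2 ⟨v, h', h2⟩⟩
      obtain ⟨x, hx, rfl⟩ := Finset.mem_image.1 hy
      rw [Finset.mem_Ico]
      refine ⟨?_, Fin.is_lt _⟩
      by_contra hc
      have : x ∈ t ∩ I := Finset.mem_inter.2 ⟨hx, (h1 x).1 (by omega)⟩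
      rw [h''] at this
      simp at this
  rcases hI with hI | hI
  · right
    rw [hI] at key
    exact iso_of hH h σ K4S8_verts K4S8_card hc (by rw [K4S8_edges]; exact key)
  · left
    rw [hI] at key
    exact iso_of hH h σ K5S7_verts K5S7_card hc (by rw [K5S7_edges]; exact key)

end TR

/-- The maximum number of edges of a `P`-free 3-graph on 12 vertices not contained
in any member of `L₁₂` equals 25, attained exactly by `K_5 ∪ S_7` and `K_4 ∪ S_8`. -/
theorem fifth_order_turan_twelve :
    IsGreatest {m : ℕ | ∃ H : ThreeGraph, H.IsValid ∧ H.verts.card = 12 ∧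
      H.Free pathP ∧ (∀ G ∈ L12, ¬ G.ContainsCopy H) ∧ H.edges.card = m} 25 ∧
    ∀ H : ThreeGraph, H.IsValid → H.verts.card = 12 → H.Free pathP →
      (∀ G ∈ L12, ¬ G.ContainsCopy H) →
      (H.edges.card = 25 ↔
        (ThreeGraph.IsoCopy ((KK 5).dUnion (SS 7)) H ∨
         ThreeGraph.IsoCopy ((KK 4).dUnion (SS 8)) H)) := by
  refine ⟨⟨K5S7_mem, ?_⟩, ?_⟩
  · rintro m ⟨H, hH, hv, hF, hL, rfl⟩
    obtain ⟨φ, h⟩ := exists_Lab hv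
    rcases upper hH h hF hL with h' | h'
    · omega
    · exact h'.1
  · intro H hH hv hF hL
    constructor
    · intro hc
      obtain ⟨φ, h⟩ := exists_Lab hv
      rcases upper hH h hF hL with h' | h'
      · omega
      · exact ext_iso hH h hc h'.2
    · rintro (h | h)
      · rw [iso_card K5S7_valid h, K5S7_card]
      · rw [iso_card K4S8_valid h, K4S8_card]
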